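/- Fully discrete convergence theorem (Theorem 5.2): there exist constants B > 0, C > 0, C₁ > 0, c > 0, h₀ > 0, τ₀ > 0 and a threshold function K₀ : (0, h₀] → ℕ such that for all h ∈ (0, h₀], τ ∈ (0, τ₀] and integers K ≥ K₀(h) the following holds. Let ψ₀ ∈ V_{h,K} with N_h(ψ₀) = 1 and ‖ i_h ψ₀ − η ‖_{H¹} ≤ B, and define recursively ψ_{n+1} = ψ*_n/√(N_h(ψ*_n)), where ψ*_n ∈ ℝ^ℤ is the solution of ψ*_n{}^ℓ = ψ_n^ℓ + τ·( (1/2)·(Δ_h ψ*_n)^ℓ + (ψ_n^ℓ)²·ψ*_n{}^ℓ ) for |ℓ| ≤ K and ψ*_n{}^ℓ = 0 for |ℓ| > K. Then this recursion is well defined and for all n ≥ 0, ‖ i_h ψ_n − η ‖_{H¹} ≤ C·( e^{−c·n·τ} + h + h^{−2}·e^{−C₁·h·K} ). -/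

import Mathlib

open MeasureTheory

/-- The ground state `η(x) = (1/2) sech(x/2)`. -/
noncomputable def eta (x : ℝ) : ℝ := (1/2) * (1 / Real.cosh (x/2))

/-- Squared `H¹` norm: `‖f‖_{H¹}² = ∫ (f² + f'²)`. -/
noncomputable def H1sq (f : ℝ → ℝ) : ℝ := ∫ x : ℝ, ((f x)^2 + (deriv f x)^2)

/-- Discrete Laplacian with mesh `h`: `(Δ_h φ)^ℓ = (φ^{ℓ+1} + φ^{ℓ−1} − 2φ^ℓ)/h²`. -/
noncomputable def dLap (h : ℝ) (φ : ℤ → ℝ) (ℓ : ℤ) : ℝ :=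
  (φ (ℓ + 1) + φ (ℓ - 1) - 2 * φ ℓ) / h^2

/-- Squared discrete `L²` norm: `N_h(φ) = h ∑_j (φ^j)²`. -/
noncomputable def Nh (h : ℝ) (φ : ℤ → ℝ) : ℝ := h * ∑' j : ℤ, (φ j)^2

/-- Membership in `V_{h,K}`: symmetric sequences vanishing for `|j| > K`. -/
def memV (K : ℕ) (φ : ℤ → ℝ) : Prop :=
  (∀ j : ℤ, φ (-j) = φ j) ∧ ∀ j : ℤ, (K : ℤ) < |j| → φ j = 0

/-- The hat function `s(x) = 1 − |x|` for `|x| ≤ 1`, `0` otherwise. -/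
noncomputable def hatFn (x : ℝ) : ℝ := if |x| ≤ 1 then 1 - |x| else 0

/-- Piecewise linear interpolation `i_h ψ (x) = ∑_j ψ^j s(x/h − j)`. -/
noncomputable def ih (h : ℝ) (φ : ℤ → ℝ) (x : ℝ) : ℝ :=
  ∑' j : ℤ, φ j * hatFn (x / h - (j : ℝ))

/-- `(ψ, ψ*)` implements the fully discrete linearly implicit normalized gradient scheme:
at each step `n`, `ψ*_n` solves the linearly implicit system with homogeneous Dirichlet
conditions outside `|ℓ| ≤ K`, has positive discrete `L²` norm, and
`ψ_{n+1} = ψ*_n / √(N_h(ψ*_n))`. -/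
def FullyDiscreteScheme (h : ℝ) (K : ℕ) (τ : ℝ) (ψ ψs : ℕ → ℤ → ℝ) : Prop :=
  ∀ n : ℕ,
    (∀ ℓ : ℤ, (K : ℤ) < |ℓ| → ψs n ℓ = 0) ∧
    (∀ ℓ : ℤ, |ℓ| ≤ (K : ℤ) →
      ψs n ℓ = ψ n ℓ + τ * ((1/2) * dLap h (ψs n) ℓ + (ψ n ℓ)^2 * ψs n ℓ)) ∧
    0 < Nh h (ψs n) ∧
    ψ (n + 1) = fun ℓ => ψs n ℓ / Real.sqrt (Nh h (ψs n))

theorem Real.hasDerivAt_tanh_half (x : ℝ) :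
    HasDerivAt (fun x => Real.tanh (x / 2)) ((1 - Real.tanh (x / 2) ^ 2) / 2) x := by
  have hc : Real.cosh (x / 2) ≠ 0 := (Real.cosh_pos _).ne'
  have h2 : HasDerivAt (fun x : ℝ => x / 2) (1 / 2) x := (hasDerivAt_id x).div_const 2
  have h := (h2.sinh).fun_div (h2.cosh) hc
  simp only [Real.tanh_eq_sinh_div_cosh]
  refine h.congr_deriv ?_
  field_simp

theorem eta_pos (x : ℝ) : 0 < eta x := by
  have := Real.cosh_pos (x / 2)
  unfold eta; positivity

theorem eta_sq (x : ℝ) : eta x ^ 2 = (1 - Real.tanh (x / 2) ^ 2) / 4 := by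
  have hc : Real.cosh (x / 2) ≠ 0 := (Real.cosh_pos _).ne'
  have h := Real.cosh_sq (x / 2)
  rw [eta, Real.tanh_eq_sinh_div_cosh]
  field_simp
  linarith

theorem hasDerivAt_eta (x : ℝ) :
    HasDerivAt eta (-(Real.tanh (x / 2) * eta x) / 2) x := by
  have hc : Real.cosh (x / 2) ≠ 0 := (Real.cosh_pos _).ne'
  have h2 : HasDerivAt (fun x : ℝ => x / 2) (1 / 2) x := (hasDerivAt_id x).div_const 2
  have h := ((hasDerivAt_const x (1 : ℝ)).fun_div (h2.cosh) hc).const_mul (1 / 2)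
  have e : eta = fun x => 1 / 2 * (1 / Real.cosh (x / 2)) := rfl
  rw [e]
  refine h.congr_deriv ?_
  rw [Real.tanh_eq_sinh_div_cosh]
  field_simp
  ring

theorem eta_le_half (x : ℝ) : eta x ≤ 1 / 2 := by
  have := eta_sq x
  have := eta_pos x
  nlinarith [sq_nonneg (Real.tanh (x / 2))]

theorem eta_neg (x : ℝ) : eta (-x) = eta x := by
  simp [eta, neg_div, Real.cosh_neg]

theorem eta_le_exp (x : ℝ) : eta x ≤ Real.exp (-x / 2) := by
  have h1 : Real.cosh (x / 2) = (Real.exp (x / 2) + Real.exp (-(x / 2))) / 2 := Real.cosh_eq _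
  have h2 := Real.exp_pos (x / 2)
  have h3 := Real.exp_pos (-(x / 2))
  have h4 : Real.exp (x / 2) * Real.exp (-x / 2) = 1 := by
    rw [← Real.exp_add]; simp; ring
  have h5 := Real.exp_pos (-x / 2)
  unfold eta
  rw [mul_one_div, div_le_iff₀ (Real.cosh_pos _), h1]
  nlinarith [mul_pos h5 h3]

theorem abs_tanh_half_le (x : ℝ) : |Real.tanh (x / 2)| ≤ 1 := by
  have := eta_sq x
  have := sq_nonneg (eta x)
  rw [abs_le]
  constructor <;> nlinarith

theorem tanh_half_nonneg {x : ℝ} (hx : 0 ≤ x) : 0 ≤ Real.tanh (x / 2) := by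
  rw [Real.tanh_eq_sinh_div_cosh]
  exact div_nonneg (Real.sinh_nonneg_iff.2 (by linarith)) (Real.cosh_pos _).le

theorem continuous_eta : Continuous eta :=
  continuous_iff_continuousAt.2 fun x => (hasDerivAt_eta x).continuousAt

theorem continuous_tanh_half : Continuous fun x : ℝ => Real.tanh (x / 2) :=
  continuous_iff_continuousAt.2 fun x => (Real.hasDerivAt_tanh_half x).continuousAt

theorem one_sub_tanh_half_le (x : ℝ) : 1 - Real.tanh (x / 2) ≤ 2 * Real.exp (-x) := by
  have hc := Real.cosh_pos (x / 2)
  have h1 := Real.cosh_eq (x / 2)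
  have h1' := Real.sinh_eq (x / 2)
  have h4 : Real.exp (-(x / 2)) = Real.exp (x / 2) * Real.exp (-x) := by
    rw [← Real.exp_add]; ring_nf
  have h2 := Real.exp_pos (x / 2)
  have h5 := Real.exp_pos (-x)
  have : 1 - Real.tanh (x / 2) = (Real.cosh (x / 2) - Real.sinh (x / 2)) / Real.cosh (x / 2) := by
    rw [Real.tanh_eq_sinh_div_cosh]; field_simp
  rw [this, div_le_iff₀ hc, h1, h1', h4]
  nlinarith [mul_pos h2 (mul_pos h5 h5)]

/-- Measurable functions that are bounded on bounded sets. -/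
structure LocBdd (g : ℝ → ℝ) : Prop where
  measurable : Measurable g
  bdd : ∀ R : ℝ, ∃ C : ℝ, ∀ x, |x| ≤ R → |g x| ≤ C

namespace LocBdd

theorem of_continuous {g : ℝ → ℝ} (hg : Continuous g) : LocBdd g := by
  refine ⟨hg.measurable, fun R => ?_⟩
  obtain ⟨C, hC⟩ := (isCompact_Icc (a := -R) (b := R)).exists_bound_of_continuousOn hg.continuousOn
  exact ⟨C, fun x hx => hC x (abs_le.1 hx)⟩

theorem mul {f g : ℝ → ℝ} (hf : LocBdd f) (hg : LocBdd g) : LocBdd fun x => f x * g x := by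
  refine ⟨hf.1.mul hg.1, fun R => ?_⟩
  obtain ⟨C, hC⟩ := hf.2 R
  obtain ⟨D, hD⟩ := hg.2 R
  refine ⟨C * D, fun x hx => ?_⟩
  rw [abs_mul]
  exact mul_le_mul (hC x hx) (hD x hx) (abs_nonneg _) ((abs_nonneg _).trans (hC x hx))

theorem add {f g : ℝ → ℝ} (hf : LocBdd f) (hg : LocBdd g) : LocBdd fun x => f x + g x := by
  refine ⟨hf.1.add hg.1, fun R => ?_⟩
  obtain ⟨C, hC⟩ := hf.2 R
  obtain ⟨D, hD⟩ := hg.2 R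
  exact ⟨C + D, fun x hx => (abs_add_le _ _).trans (add_le_add (hC x hx) (hD x hx))⟩

theorem abs {f : ℝ → ℝ} (hf : LocBdd f) : LocBdd fun x => |f x| := by
  refine ⟨continuous_abs.measurable.comp hf.1, fun R => ?_⟩
  obtain ⟨C, hC⟩ := hf.2 R
  exact ⟨C, fun x hx => by rw [abs_abs]; exact hC x hx⟩

theorem const (c : ℝ) : LocBdd fun _ => c := of_continuous continuous_const

theorem neg {f : ℝ → ℝ} (hf : LocBdd f) : LocBdd fun x => -f x := by
  simpa using (const (-1)).mul hf

theorem sub {f g : ℝ → ℝ} (hf : LocBdd f) (hg : LocBdd g) : LocBdd fun x => f x - g x := by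
  simpa [sub_eq_add_neg] using hf.add hg.neg

theorem sq {f : ℝ → ℝ} (hf : LocBdd f) : LocBdd fun x => f x ^ 2 := by
  simpa [pow_two] using hf.mul hf

theorem intervalIntegrable {f : ℝ → ℝ} (hf : LocBdd f) (a b : ℝ) :
    IntervalIntegrable f volume a b := by
  obtain ⟨C, hC⟩ := hf.2 (max |a| |b|)
  rw [intervalIntegrable_iff]
  refine Measure.integrableOn_of_bounded (M := C) (by simp) hf.1.aestronglyMeasurable ?_
  refine (ae_restrict_mem measurableSet_uIoc).mono fun x hx => ?_
  refine hC x ?_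
  have ha := abs_le.1 (le_max_left |a| |b|)
  have hb := abs_le.1 (le_max_right |a| |b|)
  rw [abs_le]
  rcases Set.mem_uIoc.1 hx with h | h <;> constructor <;> linarith [h.1, h.2]

end LocBdd

/-- `p'` is a locally bounded derivative of the continuous function `p` off a countable set. -/
structure PWDeriv (p p' : ℝ → ℝ) : Prop where
  cont : Continuous p
  deriv : ∃ s : Set ℝ, s.Countable ∧ ∀ x ∉ s, HasDerivAt p (p' x) x
  locBdd : LocBdd p'

namespace PWDeriv

theorem of_hasDerivAt {p p' : ℝ → ℝ} (h : ∀ x, HasDerivAt p (p' x) x) (hp' : LocBdd p') :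
    PWDeriv p p' :=
  ⟨continuous_iff_continuousAt.2 fun x => (h x).continuousAt,
    ⟨∅, Set.countable_empty, fun x _ => h x⟩, hp'⟩

theorem mul {p p' q q' : ℝ → ℝ} (hp : PWDeriv p p') (hq : PWDeriv q q') :
    PWDeriv (fun x => p x * q x) (fun x => p' x * q x + p x * q' x) := by
  obtain ⟨s, hs, hsd⟩ := hp.deriv
  obtain ⟨t, ht, htd⟩ := hq.deriv
  refine ⟨hp.cont.mul hq.cont, ⟨s ∪ t, hs.union ht, fun x hx => ?_⟩, ?_⟩
  · simp only [Set.mem_union, not_or] at hx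
    exact (hsd x hx.1).fun_mul (htd x hx.2)
  · exact (hp.locBdd.mul (.of_continuous hq.cont)).add ((LocBdd.of_continuous hp.cont).mul hq.locBdd)

theorem sub {p p' q q' : ℝ → ℝ} (hp : PWDeriv p p') (hq : PWDeriv q q') :
    PWDeriv (fun x => p x - q x) (fun x => p' x - q' x) := by
  obtain ⟨s, hs, hsd⟩ := hp.deriv
  obtain ⟨t, ht, htd⟩ := hq.deriv
  refine ⟨hp.cont.sub hq.cont, ⟨s ∪ t, hs.union ht, fun x hx => ?_⟩, hp.locBdd.sub hq.locBdd⟩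
  simp only [Set.mem_union, not_or] at hx
  exact (hsd x hx.1).fun_sub (htd x hx.2)

theorem integral_eq {p p' : ℝ → ℝ} (hp : PWDeriv p p') (a b : ℝ) :
    ∫ x in a..b, p' x = p b - p a := by
  obtain ⟨s, hs, hsd⟩ := hp.deriv
  exact integral_eq_of_hasDerivAt_off_countable p p' hs hp.cont.continuousOn
    (fun x hx => hsd x hx.2) (hp.locBdd.intervalIntegrable a b)

end PWDeriv

theorem sq_integral_mul_le {f g : ℝ → ℝ} (hf : LocBdd f) (hg : LocBdd g) {a b : ℝ} (hab : a ≤ b) :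
    (∫ x in a..b, f x * g x) ^ 2 ≤ (∫ x in a..b, f x ^ 2) * ∫ x in a..b, g x ^ 2 := by
  have key : ∀ t : ℝ, 0 ≤ (∫ x in a..b, g x ^ 2) * (t * t) + (2 * ∫ x in a..b, f x * g x) * t
      + ∫ x in a..b, f x ^ 2 := by
    intro t
    have h0 : 0 ≤ ∫ x in a..b, (f x + t * g x) ^ 2 :=
      intervalIntegral.integral_nonneg hab fun x _ => sq_nonneg _
    have e : ∫ x in a..b, (f x + t * g x) ^ 2
        = ∫ x in a..b, (f x ^ 2 + (2 * t) * (f x * g x)) + t ^ 2 * g x ^ 2 := by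
      congr 1; ext x; ring
    rw [e, intervalIntegral.integral_add, intervalIntegral.integral_add,
      intervalIntegral.integral_const_mul, intervalIntegral.integral_const_mul] at h0
    · linarith
    · exact hf.sq.intervalIntegrable _ _
    · exact ((LocBdd.const _).mul (hf.mul hg)).intervalIntegrable _ _
    · exact (hf.sq.add ((LocBdd.const _).mul (hf.mul hg))).intervalIntegrable _ _
    · exact ((LocBdd.const _).mul hg.sq).intervalIntegrable _ _
  have := discrim_le_zero key
  unfold discrim at this
  linarith

theorem sq_integral_le {f : ℝ → ℝ} (hf : LocBdd f) {a b : ℝ} (hab : a ≤ b) :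
    (∫ x in a..b, f x) ^ 2 ≤ (b - a) * ∫ x in a..b, f x ^ 2 := by
  have := sq_integral_mul_le (LocBdd.const 1) hf hab
  simpa using this

namespace PWDeriv

variable {p p' : ℝ → ℝ}

theorem abs_sub_le (hp : PWDeriv p p') {a b x y : ℝ} (hx : x ∈ Set.Icc a b)
    (hy : y ∈ Set.Icc a b) : |p x - p y| ≤ ∫ t in a..b, |p' t| := by
  have main : ∀ {x y : ℝ}, x ∈ Set.Icc a b → y ∈ Set.Icc a b → x ≤ y →
      |p y - p x| ≤ ∫ t in a..b, |p' t| := by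
    intro x y hx hy hxy
    rw [← hp.integral_eq x y]
    refine (intervalIntegral.abs_integral_le_integral_abs hxy).trans ?_
    exact intervalIntegral.integral_mono_interval hx.1 hxy hy.2
      (Filter.Eventually.of_forall fun _ => abs_nonneg _) (hp.locBdd.abs.intervalIntegrable a b)
  rcases le_total x y with h | h
  · rw [abs_sub_comm]; exact main hx hy h
  · exact main hy hx h

theorem sq_sub_le (hp : PWDeriv p p') {a b x y : ℝ} (hab : a ≤ b) (hx : x ∈ Set.Icc a b)
    (hy : y ∈ Set.Icc a b) : (p x - p y) ^ 2 ≤ (b - a) * ∫ t in a..b, p' t ^ 2 := by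
  have h1 := hp.abs_sub_le hx hy
  have h2 := sq_integral_le hp.locBdd.abs hab
  simp only [sq_abs] at h2
  have h3 : |p x - p y| ^ 2 ≤ (∫ t in a..b, |p' t|) ^ 2 :=
    pow_le_pow_left₀ (abs_nonneg _) h1 2
  rw [sq_abs] at h3
  exact h3.trans h2

end PWDeriv

theorem LocBdd.sum_cells {g : ℝ → ℝ} (hg : LocBdd g) (h : ℝ) (n : ℕ) :
    ∑ j ∈ Finset.range n, ∫ x in (j * h)..((j + 1 : ℕ) * h), g x = ∫ x in 0..(n * h), g x := by
  have := intervalIntegral.sum_integral_adjacent_intervals (f := g) (μ := volume)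
    (a := fun j : ℕ => (j : ℝ) * h) (n := n) (fun k _ => hg.intervalIntegrable _ _)
  simpa using this

theorem cell_le {h : ℝ} (hh : 0 < h) (j : ℕ) : (j : ℝ) * h ≤ ((j + 1 : ℕ) : ℝ) * h := by
  push_cast; nlinarith

theorem cell_length (h : ℝ) (j : ℕ) : ((j + 1 : ℕ) : ℝ) * h - j * h = h := by
  push_cast; ring

namespace PWDeriv

variable {p p' : ℝ → ℝ} {h : ℝ}

/-- Error bound for the left rectangle rule. -/
theorem abs_integral_sub_sum_le (hp : PWDeriv p p') (hh : 0 < h) (n : ℕ) :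
    |(∫ x in 0..(n * h), p x) - h * ∑ j ∈ Finset.range n, p (j * h)|
      ≤ h * ∫ x in 0..(n * h), |p' x| := by
  rw [← (LocBdd.of_continuous hp.cont).sum_cells, ← hp.locBdd.abs.sum_cells, Finset.mul_sum,
    Finset.mul_sum, ← Finset.sum_sub_distrib]
  refine (Finset.abs_sum_le_sum_abs _ _).trans (Finset.sum_le_sum fun j _ => ?_)
  have hab := cell_le hh j
  have e : (∫ x in (j * h)..((j + 1 : ℕ) * h), p x) - h * p (j * h)
      = ∫ x in (j * h)..((j + 1 : ℕ) * h), (p x - p (j * h)) := by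
    rw [intervalIntegral.integral_sub (hp.cont.intervalIntegrable _ _) (by simp),
      intervalIntegral.integral_const, cell_length, smul_eq_mul]
  rw [e]
  have := intervalIntegral.norm_integral_le_of_norm_le_const
    (f := fun x => p x - p (j * h)) (a := j * h) (b := (j + 1 : ℕ) * h)
    (C := ∫ x in (j * h)..((j + 1 : ℕ) * h), |p' x|) (fun x hx => by
      rw [Set.uIoc_of_le hab] at hx
      exact hp.abs_sub_le ⟨hx.1.le, hx.2⟩ ⟨le_rfl, hab⟩)
  rw [cell_length, abs_of_pos hh] at this
  exact this.trans_eq (mul_comm _ _)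

theorem sum_sq_le (hp : PWDeriv p p') (hh : 0 < h) (n : ℕ) :
    h * ∑ j ∈ Finset.range n, p (j * h) ^ 2
      ≤ (1 + h) * ∫ x in 0..(n * h), (p x ^ 2 + p' x ^ 2) := by
  have h1 := (abs_le.1 ((hp.mul hp).abs_integral_sub_sum_le hh n)).1
  have hn : (0 : ℝ) ≤ n * h := by positivity
  have hpp := LocBdd.of_continuous hp.cont
  have h2 : ∫ x in 0..(n * h), |p' x * p x + p x * p' x|
      ≤ ∫ x in 0..(n * h), (p x ^ 2 + p' x ^ 2) := by
    refine intervalIntegral.integral_mono hn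
      (((hp.locBdd.mul hpp).add (hpp.mul hp.locBdd)).abs.intervalIntegrable _ _)
      ((hpp.sq.add hp.locBdd.sq).intervalIntegrable _ _) fun x => ?_
    simp only
    rw [abs_le]
    constructor <;> nlinarith [sq_nonneg (p x - p' x), sq_nonneg (p x + p' x)]
  have h3 : ∫ x in 0..(n * h), p x * p x ≤ ∫ x in 0..(n * h), (p x ^ 2 + p' x ^ 2) := by
    refine intervalIntegral.integral_mono hn ((hpp.mul hpp).intervalIntegrable _ _)
      ((hpp.sq.add hp.locBdd.sq).intervalIntegrable _ _) fun x => ?_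
    simp only
    nlinarith [sq_nonneg (p' x)]
  have e : ∑ j ∈ Finset.range n, p (j * h) ^ 2 = ∑ j ∈ Finset.range n, p (j * h) * p (j * h) := by
    simp only [pow_two]
  rw [e]
  have := mul_le_mul_of_nonneg_left h2 hh.le
  linarith

theorem sum_diff_sq_le (hp : PWDeriv p p') (hh : 0 < h) (n : ℕ) :
    h * ∑ j ∈ Finset.range n, ((p ((j + 1 : ℕ) * h) - p (j * h)) / h) ^ 2
      ≤ ∫ x in 0..(n * h), p' x ^ 2 := by
  rw [← hp.locBdd.sq.sum_cells, Finset.mul_sum]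
  refine Finset.sum_le_sum fun j _ => ?_
  have hab := cell_le hh j
  have := hp.sq_sub_le hab ⟨hab, le_rfl⟩ ⟨le_rfl, hab⟩
  rw [cell_length] at this
  rw [div_pow, mul_div_assoc', div_le_iff₀ (by positivity)]
  nlinarith

theorem integral_sq_le (hp : PWDeriv p p') (hh : 0 < h) (n : ℕ) :
    ∫ x in 0..(n * h), p x ^ 2
      ≤ 2 * (h * ∑ j ∈ Finset.range n, p (j * h) ^ 2) + 2 * h ^ 2 * ∫ x in 0..(n * h), p' x ^ 2 := by
  rw [← hp.locBdd.sq.sum_cells, ← (LocBdd.of_continuous hp.cont).sq.sum_cells, Finset.mul_sum,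
    Finset.mul_sum, Finset.mul_sum, ← Finset.sum_add_distrib]
  refine Finset.sum_le_sum fun j _ => ?_
  have hab := cell_le hh j
  have key : ∀ x ∈ Set.Icc (j * h) ((j + 1 : ℕ) * h), p x ^ 2
      ≤ 2 * p (j * h) ^ 2 + 2 * (h * ∫ t in (j * h)..((j + 1 : ℕ) * h), p' t ^ 2) := by
    intro x hx
    have := hp.sq_sub_le hab hx ⟨le_rfl, hab⟩
    rw [cell_length] at this
    nlinarith [sq_nonneg (p x - 2 * p (j * h))]
  have := intervalIntegral.integral_mono_on hab
    ((LocBdd.of_continuous hp.cont).sq.intervalIntegrable _ _) (by simp) key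
  rw [intervalIntegral.integral_const, cell_length, smul_eq_mul] at this
  linarith

theorem integral_deriv_sub_slope_sq_le {q q' q'' : ℝ → ℝ} (hq : PWDeriv q q')
    (hq' : PWDeriv q' q'') {a b : ℝ} (hab : a < b) :
    ∫ x in a..b, (q' x - (q b - q a) / (b - a)) ^ 2 ≤ (b - a) ^ 2 * ∫ x in a..b, q'' x ^ 2 := by
  set L := ∫ x in a..b, |q'' x| with hL
  have hba : 0 < b - a := sub_pos.2 hab
  have hL2 : L ^ 2 ≤ (b - a) * ∫ x in a..b, q'' x ^ 2 := by
    have := sq_integral_le hq'.locBdd.abs hab.le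
    simpa only [sq_abs] using this
  have key : ∀ x ∈ Set.Icc a b, (q' x - (q b - q a) / (b - a)) ^ 2 ≤ L ^ 2 := by
    intro x hx
    have e : q' x - (q b - q a) / (b - a) = (∫ y in a..b, (q' x - q' y)) / (b - a) := by
      rw [intervalIntegral.integral_sub (by simp) (hq'.cont.intervalIntegrable _ _),
        hq.integral_eq, intervalIntegral.integral_const, smul_eq_mul]
      field_simp
    have h1 : ‖∫ y in a..b, (q' x - q' y)‖ ≤ L * |b - a| :=
      intervalIntegral.norm_integral_le_of_norm_le_const fun y hy => by
        rw [Set.uIoc_of_le hab.le] at hy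
        exact hq'.abs_sub_le hx ⟨hy.1.le, hy.2⟩
    rw [e, div_pow, div_le_iff₀ (by positivity), ← mul_pow, ← sq_abs]
    rw [abs_of_pos hba] at h1
    exact pow_le_pow_left₀ (abs_nonneg _) h1 2
  have h2 := intervalIntegral.integral_mono_on hab.le
    (((LocBdd.of_continuous hq'.cont).sub (LocBdd.const _)).sq.intervalIntegrable a b)
    (by simp) key
  rw [intervalIntegral.integral_const, smul_eq_mul] at h2
  nlinarith

end PWDeriv

theorem pwDeriv_tanh_half :
    PWDeriv (fun x => Real.tanh (x / 2)) (fun x => (1 - Real.tanh (x / 2) ^ 2) / 2) :=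
  .of_hasDerivAt Real.hasDerivAt_tanh_half (.of_continuous (by
    have := continuous_tanh_half; fun_prop))

theorem pwDeriv_eta : PWDeriv eta (fun x => -(Real.tanh (x / 2) * eta x) / 2) :=
  .of_hasDerivAt hasDerivAt_eta (.of_continuous (by
    have := continuous_tanh_half; have := continuous_eta; fun_prop))

theorem pwDeriv_deriv_eta :
    PWDeriv (fun x => -(Real.tanh (x / 2) * eta x) / 2) (fun x => eta x / 4 - 2 * eta x ^ 3) := by
  refine .of_hasDerivAt (fun x => ?_) (.of_continuous (by have := continuous_eta; fun_prop))
  refine ((((Real.hasDerivAt_tanh_half x).fun_mul (hasDerivAt_eta x)).fun_neg).div_const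
    2).congr_deriv ?_
  have : Real.tanh (x / 2) ^ 2 = 1 - 4 * eta x ^ 2 := by rw [eta_sq]; ring
  linear_combination (eta x / 2) * this

theorem integral_eta_sq (a b : ℝ) :
    ∫ x in a..b, eta x ^ 2 = (Real.tanh (b / 2) - Real.tanh (a / 2)) / 2 := by
  have := pwDeriv_tanh_half.integral_eq a b
  have e : ∀ x, eta x ^ 2 = (1 / 2) * ((1 - Real.tanh (x / 2) ^ 2) / 2) := fun x => by
    rw [eta_sq]; ring
  simp only [e]
  rw [intervalIntegral.integral_const_mul, this]
  ring

theorem coercivity_coeff_left {T : ℝ} (h0 : 0 ≤ T) (h1 : T ≤ 1) :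
    0 ≤ 1 / 4 - 3 / 2 * (1 - T ^ 2) - 1 / 200 - (T / 2 + (3 * T / 2 - 2 * T ^ 2) / 80) ^ 2
      + (1 / 2 + (3 / 2 - 4 * T) / 80) * (1 - T ^ 2) / 2
      - (1 - T ^ 2) / 2 * (-2 - (1 + 4 * T) / 40) := by
  nlinarith [mul_nonneg h0 (sub_nonneg.2 h1), mul_nonneg (mul_nonneg h0 h0) (sub_nonneg.2 h1),
    mul_nonneg (mul_nonneg h0 (sub_nonneg.2 h1)) (sub_nonneg.2 h1),
    mul_nonneg (mul_nonneg h0 h0) (mul_nonneg h0 (sub_nonneg.2 h1)), sq_nonneg (T - 1/2)]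

theorem coercivity_coeff_right {T : ℝ} (h0 : 0 ≤ T) (h1 : T ≤ 1) :
    (-2 - (1 + 4 * T) / 40) ^ 2
      ≤ 2 * (-(-2 - (1 + 4 * T) / 40) / 2 + T / 20 + T / 10
        - (1 / 2 + (3 / 2 - 4 * T) / 80) * (-2 - (1 + 4 * T) / 40)
        + (T / 2 + (3 * T / 2 - 2 * T ^ 2) / 80) / 10) := by
  nlinarith [mul_nonneg h0 (sub_nonneg.2 h1), mul_nonneg (mul_nonneg h0 h0) (sub_nonneg.2 h1)]

/-- Coercivity of the linearised operator on the half line, in terms of the defect of orthogonality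
to the ground state. -/
theorem half_line_lower_bound {f f' : ℝ → ℝ} (hf : PWDeriv f f') {R : ℝ} (hR : 0 ≤ R)
    (hfR : f R = 0) {δ : ℝ} (hδ : ∫ x in 0..R, eta x * f x = δ) :
    -(81 / 40) * (δ * f 0) - δ ^ 2 / 20
      ≤ ∫ x in 0..R, (f' x ^ 2 + (1 / 4 - 6 * eta x ^ 2 - 1 / 200) * f x ^ 2) := by
  set T : ℝ → ℝ := fun x => Real.tanh (x / 2) with hT
  have hTc : Continuous T := continuous_tanh_half
  have hηc := continuous_eta
  have hfc := hf.cont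
  have hηf : Continuous fun x => eta x * f x := hηc.mul hfc
  set F : ℝ → ℝ := fun x => δ - ∫ y in 0..x, eta y * f y with hF
  have hFd : ∀ x, HasDerivAt F (-(eta x * f x)) x := fun x => by
    have := (intervalIntegral.integral_hasDerivAt_right (hηf.intervalIntegrable 0 x)
      (hηf.stronglyMeasurableAtFilter _ _) hηf.continuousAt).const_sub δ
    exact this
  have hFc : Continuous F := continuous_iff_continuousAt.2 fun x => (hFd x).continuousAt
  have hF0 : F 0 = δ := by simp [hF]
  have hFR : F R = 0 := by simp [hF, hδ]
  have hT0 : T 0 = 0 := by simp [hT]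
  set β : ℝ → ℝ := fun x => -2 - (1 + 4 * T x) / 40 with hβ
  set a : ℝ → ℝ := fun x => T x / 2 + (3 * T x / 2 - 2 * T x ^ 2) / 80 with ha
  set c : ℝ → ℝ := fun x => -(T x * β x) / 2 - (1 - T x ^ 2) / 20 - a x * β x with hc
  set T' : ℝ → ℝ := fun x => (1 - T x ^ 2) / 2 with hT'
  set a' : ℝ → ℝ := fun x => (1 / 2 + (3 / 2 - 4 * T x) / 80) * T' x with ha'
  set c' : ℝ → ℝ := fun x => (-β x / 2 + T x / 20 + T x / 10
        - (1 / 2 + (3 / 2 - 4 * T x) / 80) * β x + a x / 10) * T' x with hc'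
  have hTd : ∀ x, HasDerivAt T (T' x) x := Real.hasDerivAt_tanh_half
  have hβd : ∀ x, HasDerivAt β (-(T' x) / 10) x := fun x => by
    refine ((((hTd x).const_mul 4).const_add 1).div_const 40 |>.const_sub (-2)).congr_deriv ?_
    ring
  have had : ∀ x, HasDerivAt a (a' x) x := fun x => by
    refine (((hTd x).div_const 2).fun_add (((((hTd x).const_mul 3).div_const 2).fun_sub
      (((hTd x).fun_pow 2).const_mul 2)).div_const 80)).congr_deriv ?_
    simp only [ha']; ring
  have hcd : ∀ x, HasDerivAt c (c' x) x := fun x => by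
    refine ((((hTd x).fun_mul (hβd x)).fun_neg.div_const 2).fun_sub
      ((((hTd x).fun_pow 2).const_sub 1).div_const 20) |>.fun_sub
      ((had x).fun_mul (hβd x))).congr_deriv ?_
    simp only [hc', ha']; ring
  set G : ℝ → ℝ := fun x => a x * f x ^ 2 + 2 * (eta x * β x * (F x * f x)) + c x * F x ^ 2 with hG
  set G' : ℝ → ℝ := fun x => (a' x * f x ^ 2
      + 2 * ((-(T x * eta x) / 2 * β x + eta x * (-(T' x) / 10)) * (F x * f x)
        + eta x * β x * (-(eta x * f x) * f x))
      + c' x * F x ^ 2 + c x * (2 * F x * -(eta x * f x)))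
      + (2 * a x * f x + 2 * (eta x * β x) * F x) * f' x with hG'
  have hβc : Continuous β := by fun_prop
  have hac : Continuous a := by fun_prop
  have hcc : Continuous c := by fun_prop
  have hGd : PWDeriv G G' := by
    obtain ⟨s, hs, hsd⟩ := hf.deriv
    refine ⟨by fun_prop, ⟨s, hs, fun x hx => ?_⟩, ?_⟩
    · refine ((((had x).fun_mul ((hsd x hx).fun_pow 2)).fun_add
        ((((hasDerivAt_eta x).fun_mul (hβd x)).fun_mul ((hFd x).fun_mul (hsd x hx))).const_mul
        2)).fun_add ((hcd x).fun_mul ((hFd x).fun_pow 2))).congr_deriv ?_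
      simp only [hG']
      ring
    · exact (LocBdd.of_continuous (by fun_prop)).add
        ((LocBdd.of_continuous (by fun_prop)).mul hf.locBdd)
  have hInt := hGd.integral_eq 0 R
  have hGR : G R = 0 := by simp [hG, hfR, hFR]
  have hη0 : eta 0 = 1 / 2 := by simp [eta]
  have hG0 : G 0 = -(81 / 40) * (δ * f 0) - δ ^ 2 / 20 := by
    simp only [hG, hF0, hc, ha, hβ, hT0, hη0]; ring
  have hQ : LocBdd fun x => f' x ^ 2 + (1 / 4 - 6 * eta x ^ 2 - 1 / 200) * f x ^ 2 :=
    hf.locBdd.sq.add (.of_continuous (by fun_prop))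
  have hnn : 0 ≤ ∫ x in 0..R,
      ((f' x ^ 2 + (1 / 4 - 6 * eta x ^ 2 - 1 / 200) * f x ^ 2) + G' x) := by
    refine intervalIntegral.integral_nonneg hR fun x hx => ?_
    have hη : eta x ^ 2 = (1 - T x ^ 2) / 4 := eta_sq x
    have hTx0 : 0 ≤ T x := tanh_half_nonneg hx.1
    have hTx1 : T x ≤ 1 := (abs_le.1 (abs_tanh_half_le x)).2
    have h1 := mul_nonneg (coercivity_coeff_left hTx0 hTx1) (sq_nonneg (f x))
    have h2 := mul_nonneg (mul_nonneg (sq_nonneg (eta x))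
      (sub_nonneg.2 (coercivity_coeff_right hTx0 hTx1))) (sq_nonneg (F x))
    have h3 := sq_nonneg (f' x + a x * f x + eta x * β x * F x)
    refine le_of_le_of_eq (add_nonneg (add_nonneg h3 h1) h2) ?_
    simp only [hG', ha', hc', hc, ha, hβ, hT']
    linear_combination (2 * (-(-2 - (1 + 4 * T x) / 40) / 2 + T x / 20 + T x / 10
        - (1 / 2 + (3 / 2 - 4 * T x) / 80) * (-2 - (1 + 4 * T x) / 40)
        + (T x / 2 + (3 * T x / 2 - 2 * T x ^ 2) / 80) / 10) * F x ^ 2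
        + (6 + 2 * (-2 - (1 + 4 * T x) / 40)) * f x ^ 2) * hη
  rw [intervalIntegral.integral_add (hQ.intervalIntegrable _ _)
    (hGd.locBdd.intervalIntegrable _ _), hInt, hGR, hG0] at hnn
  linarith

theorem hatFn_eq_zero {x : ℝ} (hx : 1 ≤ |x|) : hatFn x = 0 := by
  unfold hatFn
  split_ifs with h
  · linarith
  · rfl

theorem continuous_hatFn : Continuous hatFn := by
  have : hatFn = fun x => max (1 - |x|) 0 := by
    ext x
    unfold hatFn
    split_ifs with h
    · rw [max_eq_left (by linarith)]
    · rw [max_eq_right (by linarith)]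
  rw [this]
  fun_prop

theorem ih_eq (h : ℝ) (w : ℤ → ℝ) (x : ℝ) :
    ih h w x = w ⌊x / h⌋ + Int.fract (x / h) * (w (⌊x / h⌋ + 1) - w ⌊x / h⌋) := by
  set y := x / h with hy
  set m := ⌊y⌋ with hm
  have h0 := Int.fract_nonneg y
  have h1 := (Int.fract_lt_one y).le
  have hym : y = m + Int.fract y := (Int.floor_add_fract y).symm
  unfold ih
  rw [← hy, tsum_eq_sum (s := {m, m + 1})]
  · rw [Finset.sum_pair (by lia)]
    have e1 : hatFn (y - m) = 1 - Int.fract y := by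
      have : y - m = Int.fract y := by linarith
      rw [this, hatFn, abs_of_nonneg h0, if_pos h1]
    have e2 : hatFn (y - (m + 1 : ℤ)) = Int.fract y := by
      have : y - (m + 1 : ℤ) = -(1 - Int.fract y) := by push_cast; linarith
      rw [this, hatFn, abs_neg, abs_of_nonneg (by linarith), if_pos (by linarith)]
      ring
    rw [e1, e2]; ring
  · intro b hb
    simp only [Finset.mem_insert, Finset.mem_singleton, not_or] at hb
    rw [hatFn_eq_zero, mul_zero]
    rcases lt_or_ge b m with hlt | hge
    · have : (b : ℝ) + 1 ≤ m := by exact_mod_cast hlt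
      rw [abs_of_nonneg (by linarith)]; linarith
    · have : m + 2 ≤ b := by lia
      have : (m : ℝ) + 2 ≤ b := by exact_mod_cast this
      rw [abs_of_nonpos (by linarith)]; linarith

theorem ih_grid {h : ℝ} (hh : 0 < h) (w : ℤ → ℝ) (j : ℤ) : ih h w (j * h) = w j := by
  rw [ih_eq, mul_div_cancel_right₀ _ hh.ne']
  simp

/-- The slope of the piecewise linear interpolant. -/
noncomputable def slopeFn (h : ℝ) (w : ℤ → ℝ) (x : ℝ) : ℝ := (w (⌊x / h⌋ + 1) - w ⌊x / h⌋) / h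

theorem floor_div_of_mem {h x : ℝ} (hh : 0 < h) {j : ℤ} (hx : x ∈ Set.Ioo (j * h) ((j + 1) * h)) :
    ⌊x / h⌋ = j := by
  rw [Int.floor_eq_iff]
  exact ⟨(le_div_iff₀ hh).2 hx.1.le, (div_lt_iff₀ hh).2 hx.2⟩

theorem mem_Ioo_floor {h x : ℝ} (hh : 0 < h) (hx : ∀ j : ℤ, (j : ℝ) * h ≠ x) :
    x ∈ Set.Ioo (⌊x / h⌋ * h) ((⌊x / h⌋ + 1) * h) := by
  refine ⟨lt_of_le_of_ne ((le_div_iff₀ hh).1 (Int.floor_le _)) (hx _), ?_⟩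
  exact (div_lt_iff₀ hh).1 (Int.lt_floor_add_one _)

/-- Sequences supported in `[-K, K]`. -/
def SuppIn (K : ℕ) (w : ℤ → ℝ) : Prop := ∀ j : ℤ, (K : ℤ) < |j| → w j = 0

theorem SuppIn.abs_le {K : ℕ} {w : ℤ → ℝ} (hw : SuppIn K w) (j : ℤ) :
    |w j| ≤ ∑ i ∈ Finset.Icc (-(K : ℤ)) K, |w i| := by
  by_cases hj : (K : ℤ) < |j|
  · rw [hw j hj, abs_zero]
    exact Finset.sum_nonneg fun _ _ => abs_nonneg _
  · refine Finset.single_le_sum (f := fun i => |w i|) (fun _ _ => abs_nonneg _) ?_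
    rw [Finset.mem_Icc]
    exact _root_.abs_le.1 (not_lt.1 hj)

theorem pwDeriv_ih {h : ℝ} (hh : 0 < h) {K : ℕ} {w : ℤ → ℝ} (hw : SuppIn K w) :
    PWDeriv (ih h w) (slopeFn h w) := by
  refine ⟨?_, ⟨Set.range fun j : ℤ => (j : ℝ) * h, Set.countable_range _, fun x hx => ?_⟩, ?_, ?_⟩
  · have : ih h w = fun x => ∑ j ∈ Finset.Icc (-(K : ℤ)) K, w j * hatFn (x / h - j) := by
      ext x
      unfold ih
      refine tsum_eq_sum fun b hb => ?_
      rw [hw b, zero_mul]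
      by_contra hc
      exact hb (Finset.mem_Icc.2 (_root_.abs_le.1 (not_lt.1 hc)))
    rw [this]
    refine continuous_finsetSum _ fun j _ => continuous_const.mul (continuous_hatFn.comp ?_)
    fun_prop
  · have hx' : ∀ j : ℤ, (j : ℝ) * h ≠ x := fun j hj => hx ⟨j, hj⟩
    have hmem := mem_Ioo_floor hh hx'
    set m := ⌊x / h⌋ with hm
    have hd : HasDerivAt (fun y => w m + (y / h - m) * (w (m + 1) - w m)) (slopeFn h w x) x := by
      refine ((((hasDerivAt_id x).div_const h).sub_const (m : ℝ)).mul_const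
        (w (m + 1) - w m) |>.const_add (w m)).congr_deriv ?_
      unfold slopeFn
      rw [← hm]; ring
    refine hd.congr_of_eventuallyEq ?_
    filter_upwards [isOpen_Ioo.mem_nhds hmem] with y hy
    rw [ih_eq, Int.fract, floor_div_of_mem hh hy]
  · have h1 : Measurable fun x : ℝ => ⌊x / h⌋ := (measurable_id.div_const h).floor
    have h2 : Measurable w := measurable_of_countable w
    exact ((h2.comp (h1.add_const 1)).sub (h2.comp h1)).div_const h
  · intro R
    refine ⟨(2 * ∑ i ∈ Finset.Icc (-(K : ℤ)) K, |w i|) / h, fun x _ => ?_⟩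
    unfold slopeFn
    rw [abs_div, abs_of_pos hh]
    gcongr
    have := hw.abs_le (⌊x / h⌋ + 1)
    have := hw.abs_le ⌊x / h⌋
    have := abs_sub (w (⌊x / h⌋ + 1)) (w ⌊x / h⌋)
    linarith

theorem integral_cell_comp_slopeFn {h : ℝ} (hh : 0 < h) (w : ℤ → ℝ) (g : ℝ → ℝ → ℝ) (j : ℕ) :
    ∫ x in (j * h)..((j + 1 : ℕ) * h), g x (slopeFn h w x)
      = ∫ x in (j * h)..((j + 1 : ℕ) * h), g x ((w (j + 1) - w j) / h) := by
  refine intervalIntegral.integral_congr_Ioo_of_le (cell_le hh j) fun x hx => ?_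
  have : ⌊x / h⌋ = (j : ℤ) := floor_div_of_mem hh (by push_cast at hx ⊢; exact hx)
  simp only [slopeFn, this]

theorem integral_slopeFn_sq {h : ℝ} (hh : 0 < h) {K : ℕ} {w : ℤ → ℝ} (hw : SuppIn K w) (n : ℕ) :
    ∫ x in 0..(n * h), slopeFn h w x ^ 2
      = h * ∑ j ∈ Finset.range n, ((w (j + 1) - w j) / h) ^ 2 := by
  rw [← (pwDeriv_ih hh hw).locBdd.sq.sum_cells, Finset.mul_sum]
  refine Finset.sum_congr rfl fun j _ => ?_
  rw [integral_cell_comp_slopeFn hh w (fun _ s => s ^ 2)]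
  simp [cell_length, -Nat.cast_add]

/-- The discrete `L²` inner product over `[-K, K]`. -/
noncomputable def ip (h : ℝ) (K : ℕ) (f g : ℤ → ℝ) : ℝ :=
  h * ∑ j ∈ Finset.Icc (-(K : ℤ)) K, f j * g j

/-- The discrete Dirichlet form over the edges meeting `[-K, K]`. -/
noncomputable def gip (h : ℝ) (K : ℕ) (f g : ℤ → ℝ) : ℝ :=
  h * ∑ j ∈ Finset.Icc (-(K : ℤ) - 1) K, ((f (j + 1) - f j) / h) * ((g (j + 1) - g j) / h)

theorem sum_Icc_even {f : ℤ → ℝ} (hf : ∀ j, f (-j) = f j) (K : ℕ) :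
    ∑ j ∈ Finset.Icc (-(K : ℤ)) K, f j = 2 * ∑ j ∈ Finset.range (K + 1), f j - f 0 := by
  have := Finset.sum_Icc_of_even_eq_range (f := f) hf K
  rw [this]; simp

theorem sum_Icc_edge_even {g : ℤ → ℝ} (hg : ∀ j, g (-1 - j) = g j) (K : ℕ) :
    ∑ j ∈ Finset.Icc (-(K : ℤ) - 1) K, g j = 2 * ∑ j ∈ Finset.range (K + 1), g j := by
  induction K with
  | zero =>
    have : Finset.Icc (-((0 : ℕ) : ℤ) - 1) ((0 : ℕ) : ℤ) = {-1, 0} := by decide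
    rw [this, Finset.sum_pair (by decide)]
    have := hg 0
    simp at this ⊢
    linarith
  | succ K ihK =>
    have : Finset.Icc (-((K + 1 : ℕ) : ℤ) - 1) ((K + 1 : ℕ) : ℤ)
        = insert (-1 - ((K + 1 : ℕ) : ℤ)) (insert ((K + 1 : ℕ) : ℤ)
          (Finset.Icc (-(K : ℤ) - 1) (K : ℤ))) := by
      ext j; simp only [Finset.mem_insert, Finset.mem_Icc]; lia
    rw [this, Finset.sum_insert, Finset.sum_insert, ihK, Finset.sum_range_succ _ (K + 1), hg]
    · ring
    · simp
    · simp only [Finset.mem_insert, Finset.mem_Icc]; lia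

theorem ip_even {h : ℝ} {K : ℕ} {f g : ℤ → ℝ} (hf : ∀ j, f (-j) = f j) (hg : ∀ j, g (-j) = g j) :
    ip h K f g = 2 * (h * ∑ j ∈ Finset.range (K + 1), f j * g j) - h * (f 0 * g 0) := by
  unfold ip
  rw [sum_Icc_even (fun j => by rw [hf, hg])]
  ring

theorem gip_even {h : ℝ} {K : ℕ} {f g : ℤ → ℝ} (hf : ∀ j, f (-j) = f j) (hg : ∀ j, g (-j) = g j) :
    gip h K f g = 2 * (h * ∑ j ∈ Finset.range (K + 1),
      ((f (j + 1) - f j) / h) * ((g (j + 1) - g j) / h)) := by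
  unfold gip
  rw [sum_Icc_edge_even]
  · ring
  · intro j
    have e1 : (-1 - j + 1 : ℤ) = -j := by ring
    have e2 : (-1 - j : ℤ) = -(j + 1) := by ring
    rw [e1, e2, hf, hf, hg, hg]; ring

theorem abs_mul_add_mul_le_sq (a b : ℝ) : |b * a + a * b| ≤ a ^ 2 + b ^ 2 := by
  rw [abs_le]; constructor <;> nlinarith [sq_nonneg (a + b), sq_nonneg (a - b)]

theorem eta_sq_le (x : ℝ) : eta x ^ 2 ≤ 1 / 4 := by
  have := pow_le_pow_left₀ (eta_pos x).le (eta_le_half x) 2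
  linarith

theorem eta_le_one (x : ℝ) : eta x ≤ 1 := (eta_le_half x).trans (by norm_num)

set_option maxHeartbeats 1000000 in
/-- Coercivity of the discrete linearised operator on even sequences orthogonal to the ground
state. -/
theorem discrete_coercivity {h : ℝ} (hh : 0 < h) (hh' : h ≤ 1 / 12000) {K : ℕ} {w : ℤ → ℝ}
    (hw : SuppIn K w) (hwe : ∀ j, w (-j) = w j) (hu : ip h K (fun j => eta (j * h)) w = 0) :
    (1 / 3000) * (ip h K w w + gip h K w w)
      ≤ (1 / 2) * gip h K w w + (1 / 8) * ip h K w w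
        - 3 * ip h K (fun j => eta (j * h) ^ 2 * w j) w := by
  have hf := pwDeriv_ih hh hw
  have hfc := hf.cont
  set f := ih h w with hfdef
  set f' := slopeFn h w with hf'def
  set n := K + 1 with hn
  have hfg : ∀ j : ℕ, f (j * h) = w j := fun j => by
    simpa using ih_grid hh w j
  have hR : (0 : ℝ) ≤ n * h := by positivity
  have hfR : f (n * h) = 0 := by rw [hfg]; exact hw _ (by rw [hn, abs_of_nonneg] <;> lia)
  have hf0 : f 0 = w 0 := by simpa using hfg 0
  set X := ∫ x in 0..(n * h), f x ^ 2 with hX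
  set P := ∫ x in 0..(n * h), f' x ^ 2 with hP
  have hX0 : 0 ≤ X := intervalIntegral.integral_nonneg hR fun _ _ => sq_nonneg _
  have hP0 : 0 ≤ P := intervalIntegral.integral_nonneg hR fun _ _ => sq_nonneg _
  set Y := ∫ x in 0..(n * h), eta x ^ 2 * f x ^ 2 with hY
  set δ := ∫ x in 0..(n * h), eta x * f x with hδ
  have hlf : LocBdd f := .of_continuous hfc
  have hlη : LocBdd eta := .of_continuous continuous_eta
  have main := half_line_lower_bound hf hR hfR hδ.symm
  have hsplit : ∫ x in 0..(n * h), (f' x ^ 2 + (1 / 4 - 6 * eta x ^ 2 - 1 / 200) * f x ^ 2)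
      = P + (1 / 4 - 1 / 200) * X - 6 * Y := by
    have e : ∀ x, f' x ^ 2 + (1 / 4 - 6 * eta x ^ 2 - 1 / 200) * f x ^ 2
        = f' x ^ 2 + (1 / 4 - 1 / 200) * f x ^ 2 - 6 * (eta x ^ 2 * f x ^ 2) := fun x => by ring
    simp only [e]
    rw [intervalIntegral.integral_sub, intervalIntegral.integral_add,
      intervalIntegral.integral_const_mul, intervalIntegral.integral_const_mul]
    · exact hf.locBdd.sq.intervalIntegrable _ _
    · exact ((LocBdd.const _).mul hlf.sq).intervalIntegrable _ _
    · exact (hf.locBdd.sq.add ((LocBdd.const _).mul hlf.sq)).intervalIntegrable _ _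
    · exact ((LocBdd.const _).mul (hlη.sq.mul hlf.sq)).intervalIntegrable _ _
  rw [hsplit] at main
  have hle : ∀ {g : ℝ → ℝ} {a b : ℝ}, LocBdd g →
      (∀ x, |g x| ≤ a * f x ^ 2 + b * f' x ^ 2) → ∫ x in 0..(n * h), |g x| ≤ a * X + b * P := by
    intro g a b hg hgb
    rw [hX, hP, ← intervalIntegral.integral_const_mul, ← intervalIntegral.integral_const_mul,
      ← intervalIntegral.integral_add]
    · refine intervalIntegral.integral_mono_on hR (hg.abs.intervalIntegrable _ _) ?_
        fun x _ => hgb x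
      exact (((LocBdd.const _).mul hlf.sq).add
        ((LocBdd.const _).mul hf.locBdd.sq)).intervalIntegrable _ _
    · exact ((LocBdd.const _).mul hlf.sq).intervalIntegrable _ _
    · exact ((LocBdd.const _).mul hf.locBdd.sq).intervalIntegrable _ _
  -- rectangle rule for the mass
  have hA := ip_even (h := h) (K := K) hwe hwe
  have hD := gip_even (h := h) (K := K) hwe hwe
  have hDP : gip h K w w = 2 * P := by
    rw [hD, hP, integral_slopeFn_sq hh hw]
    congr 2
    refine Finset.sum_congr rfl fun j _ => by ring
  have hS : |X - h * ∑ j ∈ Finset.range n, w j * w j| ≤ h * (X + P) := by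
    have h1 := (hf.mul hf).abs_integral_sub_sum_le hh n
    have h2 : ∫ x in 0..(n * h), |f' x * f x + f x * f' x| ≤ 1 * X + 1 * P := by
      refine hle ((hf.locBdd.mul hlf).add (hlf.mul hf.locBdd)) fun x => ?_
      rw [one_mul, one_mul]; exact abs_mul_add_mul_le_sq _ _
    simp only [hfg, ← pow_two] at h1
    rw [← hX] at h1
    simp only [← pow_two]
    refine h1.trans ?_
    gcongr
    simpa [pow_two, mul_comm] using h2
  have hη0 := fun x => (eta_pos x).le
  have hη1 := fun x => eta_le_half x
  have hT := fun x => abs_tanh_half_le x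
  have hSY : |Y - h * ∑ j ∈ Finset.range n, eta (j * h) ^ 2 * w j * w j| ≤ h * (X + P) := by
    have hηf := pwDeriv_eta.mul hf
    have h1 := (hηf.mul hηf).abs_integral_sub_sum_le hh n
    have e1 : ∀ x, eta x * f x * (eta x * f x) = eta x ^ 2 * f x ^ 2 := fun x => by ring
    have e2 : ∀ j : ℕ, eta (j * h) * w j * (eta (j * h) * w j) = eta (j * h) ^ 2 * w j * w j :=
      fun j => by ring
    simp only [e1, hfg, e2] at h1
    refine h1.trans (mul_le_mul_of_nonneg_left ?_ hh.le)
    refine (hle (a := 1) (b := 1) ?_ fun x => ?_).trans (by rw [one_mul, one_mul])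
    · exact ((hηf.mul hηf).locBdd)
    · have hT1 : |Real.tanh (x / 2) * eta x| ≤ 1 := by
        rw [abs_mul, abs_of_nonneg (hη0 x)]
        exact mul_le_one₀ (hT x) (hη0 x) (eta_le_one x)
      have e3 : (-(Real.tanh (x / 2) * eta x) / 2 * f x + eta x * f' x) * (eta x * f x)
          + eta x * f x * (-(Real.tanh (x / 2) * eta x) / 2 * f x + eta x * f' x)
          = eta x * (-(Real.tanh (x / 2) * eta x) * f x ^ 2 + eta x * (2 * (f x * f' x))) := by ring
      have e4 : |-(Real.tanh (x / 2) * eta x) * f x ^ 2 + eta x * (2 * (f x * f' x))|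
          ≤ 1 * f x ^ 2 + 1 * (f x ^ 2 + f' x ^ 2) := by
        refine (abs_add_le _ _).trans (add_le_add ?_ ?_)
        · rw [abs_mul, abs_neg, abs_of_nonneg (sq_nonneg (f x))]
          gcongr
        · rw [abs_mul, abs_of_nonneg (hη0 x)]
          refine mul_le_mul (eta_le_one x) ?_ (abs_nonneg _) zero_le_one
          have := abs_mul_add_mul_le_sq (f x) (f' x)
          rwa [mul_comm (f' x), ← two_mul] at this
      rw [e3, abs_mul, abs_of_nonneg (hη0 x)]
      have := mul_le_mul (hη1 x) e4 (abs_nonneg _) (by norm_num)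
      linarith [sq_nonneg (f' x)]
  set E := X + P with hE
  have hE0 : 0 ≤ E := by positivity
  set e := Real.sqrt E with he
  have hee : e * e = E := Real.mul_self_sqrt hE0
  have he0 : 0 ≤ e := Real.sqrt_nonneg _
  have hw0 : |w 0| ≤ e := by
    refine Real.abs_le_sqrt ?_
    have h1 := (hf.mul hf).integral_eq 0 (n * h)
    rw [hfR, hf0] at h1
    have h2 : |∫ x in 0..(n * h), (f' x * f x + f x * f' x)| ≤ 1 * X + 1 * P := by
      refine (intervalIntegral.abs_integral_le_integral_abs hR).trans ?_
      refine hle ((hf.locBdd.mul hlf).add (hlf.mul hf.locBdd)) fun x => ?_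
      rw [one_mul, one_mul]; exact abs_mul_add_mul_le_sq _ _
    have := (abs_le.1 h2).1
    rw [h1] at this
    linarith
  have hη2 : ∫ x in 0..(n * h), eta x ^ 2 ≤ 1 / 2 := by
    rw [integral_eta_sq]
    have := (abs_le.1 (hT (n * h))).2
    simp; linarith
  have hδ1 : |δ| ≤ 5 / 4 * h * e := by
    have h1 := (pwDeriv_eta.mul hf).abs_integral_sub_sum_le hh n
    simp only [hfg] at h1
    have hg := ((LocBdd.of_continuous continuous_tanh_half).mul hlf).mul (LocBdd.const (-1 / 2))
      |>.add hf.locBdd |>.abs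
    have h2 : (∫ x in 0..(n * h), |-(Real.tanh (x / 2) * eta x) / 2 * f x + eta x * f' x|)
        ≤ e := by
      refine Real.le_sqrt_of_sq_le ?_
      have e5 : ∀ x, |-(Real.tanh (x / 2) * eta x) / 2 * f x + eta x * f' x|
          = eta x * |Real.tanh (x / 2) * f x * (-1 / 2) + f' x| := fun x => by
        rw [← abs_of_nonneg (hη0 x), ← abs_mul, abs_of_nonneg (hη0 x)]
        congr 1; ring
      simp only [e5]
      refine (sq_integral_mul_le hlη hg hR).trans ?_
      have h3 : ∫ x in 0..(n * h), |Real.tanh (x / 2) * f x * (-1 / 2) + f' x| ^ 2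
          ≤ 2 * X + 2 * P := by
        have := hle (a := 2) (b := 2) hg.sq fun x => ?_
        · simpa only [abs_pow, abs_abs] using this
        · have : |Real.tanh (x / 2) * f x * (-1 / 2) + f' x| ≤ |f x| + |f' x| := by
            refine (abs_add_le _ _).trans (add_le_add ?_ le_rfl)
            rw [abs_mul, abs_mul]
            have := mul_le_mul_of_nonneg_right (hT x) (abs_nonneg (f x))
            have e6 : |(-1 / 2 : ℝ)| = 1 / 2 := by norm_num
            rw [e6]
            linarith [abs_nonneg (f x)]
          rw [abs_of_nonneg (sq_nonneg _)]
          have := (pow_le_pow_left₀ (abs_nonneg _) this 2).trans (add_sq_le (a := |f x|))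
          rw [sq_abs (f x), sq_abs (f' x)] at this
          linarith
      have := mul_le_mul hη2 h3 (intervalIntegral.integral_nonneg hR fun _ _ => sq_nonneg _)
        (by norm_num)
      linarith
    have hηe : ∀ j : ℤ, eta ((-j : ℤ) * h) = eta (j * h) := fun j => by
      push_cast; rw [neg_mul, eta_neg]
    rw [ip_even hηe hwe] at hu
    have h0 : eta ((0 : ℤ) * h) = 1 / 2 := by simp [eta]
    rw [h0] at hu
    push_cast at hu
    have h7 : |h * ∑ j ∈ Finset.range n, eta (j * h) * w j| ≤ h * (e / 4) := by
      have : h * ∑ j ∈ Finset.range n, eta (j * h) * w j = h * (w 0 / 4) := by linarith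
      rw [this, abs_mul, abs_of_pos hh, abs_div]
      gcongr
      norm_num
    have h8 := abs_add_le (δ - h * ∑ j ∈ Finset.range n, eta (j * h) * w j)
      (h * ∑ j ∈ Finset.range n, eta (j * h) * w j)
    rw [sub_add_cancel] at h8
    have := h1.trans (mul_le_mul_of_nonneg_left h2 hh.le)
    linarith
  have hδf : |δ * f 0| ≤ 5 / 4 * h * E := by
    rw [abs_mul, hf0, ← hee]
    calc |δ| * |w 0| ≤ (5 / 4 * h * e) * e := by gcongr
      _ = _ := by ring
  have hδ2 : δ ^ 2 ≤ 2 * h * E := by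
    have := pow_le_pow_left₀ (abs_nonneg _) hδ1 2
    rw [sq_abs] at this
    have h9 : (5 / 4 * h * e) ^ 2 = 25 / 16 * h * (h * E) := by rw [← hee]; ring
    rw [h9] at this
    have h10 : h * E ≤ 1 * E := by gcongr; linarith
    have := mul_le_mul_of_nonneg_left h10 hh.le
    have := mul_nonneg hh.le hE0
    linarith
  have hYX : Y ≤ X / 4 := by
    have : ∫ x in 0..(n * h), eta x ^ 2 * f x ^ 2 ≤ ∫ x in 0..(n * h), 1 / 4 * f x ^ 2 := by
      refine intervalIntegral.integral_mono_on hR ((hlη.sq.mul hlf.sq).intervalIntegrable _ _)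
        (((LocBdd.const _).mul hlf.sq).intervalIntegrable _ _) fun x _ => ?_
      exact mul_le_mul_of_nonneg_right (eta_sq_le x) (sq_nonneg _)
    rw [intervalIntegral.integral_const_mul] at this
    linarith
  have hB := ip_even (h := h) (K := K) (f := fun j => eta (j * h) ^ 2 * w j) (g := w)
    (fun j => by simp only [hwe]; push_cast; rw [neg_mul, eta_neg]) hwe
  push_cast at hB
  have hS1 := abs_le.1 hS
  have hS2 := abs_le.1 hSY
  have hw02 : w 0 * w 0 ≤ E := by
    have := mul_self_le_mul_self (abs_nonneg _) hw0
    rwa [abs_mul_abs_self, hee] at this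
  have hw03 : h * (w 0 * w 0) ≤ h * E := by gcongr
  have hw04 : 0 ≤ h * (w 0 * w 0) := mul_nonneg hh.le (mul_self_nonneg _)
  have hw05 : 0 ≤ h * (eta (0 * h) ^ 2 * w 0 * w 0) := by
    have := mul_self_nonneg (w 0)
    have : eta (0 * h) ^ 2 * w 0 * w 0 = eta (0 * h) ^ 2 * (w 0 * w 0) := by ring
    rw [this]; positivity
  have hhE : h * E ≤ 1 / 12000 * E := by gcongr
  have := abs_le.1 hδf
  rw [hDP]
  rw [← hn] at hA hB
  linarith [hS1.1, hS1.2, hS2.1, hS2.2, this.1, this.2]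

/-- The discrete `L²` norm over `[-K, K]`. -/
noncomputable def nrm (h : ℝ) (K : ℕ) (f : ℤ → ℝ) : ℝ := Real.sqrt (ip h K f f)

section ip

variable {h : ℝ} {K : ℕ} {f g : ℤ → ℝ}

theorem ip_self_nonneg (hh : 0 < h) (f : ℤ → ℝ) : 0 ≤ ip h K f f :=
  mul_nonneg hh.le (Finset.sum_nonneg fun _ _ => mul_self_nonneg _)

theorem gip_self_nonneg (hh : 0 < h) (f : ℤ → ℝ) : 0 ≤ gip h K f f :=
  mul_nonneg hh.le (Finset.sum_nonneg fun _ _ => mul_self_nonneg _)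

theorem nrm_nonneg (f : ℤ → ℝ) : 0 ≤ nrm h K f := Real.sqrt_nonneg _

theorem nrm_sq (hh : 0 < h) (f : ℤ → ℝ) : nrm h K f ^ 2 = ip h K f f :=
  Real.sq_sqrt (ip_self_nonneg hh f)

theorem ip_comm (f g : ℤ → ℝ) : ip h K f g = ip h K g f := by
  unfold ip; simp only [mul_comm]

theorem ip_congr {f' g' : ℤ → ℝ} (h1 : ∀ j : ℤ, |j| ≤ K → f j * g j = f' j * g' j) :
    ip h K f g = ip h K f' g' := by
  unfold ip
  congr 1
  exact Finset.sum_congr rfl fun j hj => h1 j (abs_le.2 (Finset.mem_Icc.1 hj))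

theorem abs_ip_le (hh : 0 < h) (f g : ℤ → ℝ) : |ip h K f g| ≤ nrm h K f * nrm h K g := by
  unfold nrm
  rw [← Real.sqrt_mul (ip_self_nonneg hh f)]
  refine Real.abs_le_sqrt ?_
  unfold ip
  have := Finset.sum_mul_sq_le_sq_mul_sq (Finset.Icc (-(K : ℤ)) K) f g
  simp only [← pow_two]
  nlinarith [sq_nonneg h]

theorem ip_le (hh : 0 < h) (f g : ℤ → ℝ) : ip h K f g ≤ nrm h K f * nrm h K g :=
  (le_abs_self _).trans (abs_ip_le hh f g)

theorem nrm_le_of_ip_le (hh : 0 < h) {a : ℝ} (ha : 0 ≤ a) (H : ip h K f f ≤ a * nrm h K f) :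
    nrm h K f ≤ a := by
  rw [← nrm_sq hh] at H
  rcases (nrm_nonneg (h := h) (K := K) f).eq_or_lt with h0 | h0
  · rwa [← h0]
  · rw [pow_two] at H
    exact le_of_mul_le_mul_right H h0

theorem nrm_add_le (hh : 0 < h) (f g : ℤ → ℝ) :
    nrm h K (fun j => f j + g j) ≤ nrm h K f + nrm h K g := by
  refine Real.sqrt_le_iff.2 ⟨add_nonneg (nrm_nonneg f) (nrm_nonneg g), ?_⟩
  have e : ip h K (fun j => f j + g j) (fun j => f j + g j)
      = ip h K f f + 2 * ip h K f g + ip h K g g := by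
    simp only [ip, Finset.mul_sum, ← Finset.sum_add_distrib]
    exact Finset.sum_congr rfl fun j _ => by ring
  rw [e, ← nrm_sq hh, ← nrm_sq hh]
  nlinarith [ip_le (K := K) hh f g]

theorem nrm_le_of_abs_le (hh : 0 < h) {a : ℝ} (ha : 0 ≤ a)
    (H : ∀ j : ℤ, |j| ≤ K → |f j| ≤ a * |g j|) : nrm h K f ≤ a * nrm h K g := by
  refine Real.sqrt_le_iff.2 ⟨mul_nonneg ha (nrm_nonneg g), ?_⟩
  rw [mul_pow, nrm_sq hh]
  unfold ip
  have : a ^ 2 * (h * ∑ j ∈ Finset.Icc (-(K : ℤ)) K, g j * g j)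
      = h * ∑ j ∈ Finset.Icc (-(K : ℤ)) K, a ^ 2 * (g j * g j) := by
    rw [← Finset.mul_sum]; ring
  rw [this]
  refine mul_le_mul_of_nonneg_left (Finset.sum_le_sum fun j hj => ?_) hh.le
  have := mul_self_le_mul_self (abs_nonneg _) (H j (abs_le.2 (Finset.mem_Icc.1 hj)))
  rw [abs_mul_abs_self] at this
  refine this.trans_eq ?_
  rw [mul_mul_mul_comm, abs_mul_abs_self, pow_two]

theorem nrm_const_mul (a : ℝ) (f : ℤ → ℝ) :
    nrm h K (fun j => a * f j) = |a| * nrm h K f := by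
  have : ip h K (fun j => a * f j) (fun j => a * f j) = a ^ 2 * ip h K f f := by
    simp only [ip, Finset.mul_sum]
    exact Finset.sum_congr rfl fun j _ => by ring
  unfold nrm
  rw [this, Real.sqrt_mul (sq_nonneg a), Real.sqrt_sq_eq_abs]

theorem ip_dLap (hh : 0 < h) (f : ℤ → ℝ) (hg : SuppIn K g) :
    ip h K (dLap h f) g = -gip h K f g := by
  set J := Finset.Icc (-(K : ℤ) - 1) K with hJ
  set I := Finset.Icc (-(K : ℤ)) K with hI
  have h1 : ∑ j ∈ J, (f (j + 1) - f j) * g (j + 1) = ∑ j ∈ I, (f j - f (j - 1)) * g j := by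
    have : ∑ j ∈ J, (f (j + 1) - f j) * g (j + 1)
        = ∑ i ∈ J.map (addRightEmbedding 1), (f i - f (i - 1)) * g i := by
      rw [Finset.sum_map]
      exact Finset.sum_congr rfl fun j _ => by simp
    rw [this, hJ, Finset.map_add_right_Icc, sub_add_cancel]
    symm
    refine Finset.sum_subset (Finset.Icc_subset_Icc le_rfl (by lia)) fun j hj hj' => ?_
    rw [hg j, mul_zero]
    simp only [hI, Finset.mem_Icc] at hj hj'
    rw [lt_abs]; lia
  have h2 : ∑ j ∈ J, (f (j + 1) - f j) * g j = ∑ j ∈ I, (f (j + 1) - f j) * g j := by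
    symm
    refine Finset.sum_subset (Finset.Icc_subset_Icc (by lia) le_rfl) fun j hj hj' => ?_
    rw [hg j, mul_zero]
    simp only [hI, hJ, Finset.mem_Icc] at hj hj'
    rw [lt_abs]; lia
  have h3 : gip h K f g = h * ((∑ j ∈ I, (f j - f (j - 1)) * g j
      - ∑ j ∈ I, (f (j + 1) - f j) * g j) / h ^ 2) := by
    rw [← h1, ← h2, ← Finset.sum_sub_distrib, Finset.sum_div]
    unfold gip
    congr 1
    refine Finset.sum_congr rfl fun j _ => ?_
    field_simp
  rw [h3, ← Finset.sum_sub_distrib, Finset.sum_div]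
  unfold ip dLap
  rw [← mul_neg, ← Finset.sum_neg_distrib]
  congr 1
  exact Finset.sum_congr rfl fun j _ => by ring

theorem gip_comm (f g : ℤ → ℝ) : gip h K f g = gip h K g f := by
  unfold gip; simp only [mul_comm]

theorem ip_dLap_comm (hh : 0 < h) (hf : SuppIn K f) (hg : SuppIn K g) :
    ip h K (dLap h f) g = ip h K (dLap h g) f := by
  rw [ip_dLap hh f hg, ip_dLap hh g hf, gip_comm]

end ip

theorem sq_le_ip_add_gip {h : ℝ} (hh : 0 < h) {K : ℕ} {w : ℤ → ℝ} (hw : SuppIn K w)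
    (hwe : ∀ j, w (-j) = w j) (j : ℤ) : w j ^ 2 ≤ ip h K w w + gip h K w w := by
  have hA := ip_even (h := h) (K := K) hwe hwe
  have hD := gip_even (h := h) (K := K) hwe hwe
  have key : ∀ n : ℕ, n ≤ K + 1 → w n ^ 2 ≤ ∑ i ∈ Finset.Ico n (K + 1),
      (h / 2 * (((w (i + 1) - w i) / h) * ((w (i + 1) - w i) / h)) + h * (w (i + 1) * w (i + 1))
        + h * (w i * w i)) := by
    intro n hn
    induction hn using Nat.decreasingInduction with
    | self =>
      rw [hw _ (by rw [abs_of_nonneg] <;> lia)]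
      simp
    | of_succ n hn ihn =>
      rw [Finset.sum_eq_sum_Ico_succ_bot hn]
      push_cast at ihn ⊢
      refine le_trans ?_ (add_le_add_right ihn _)
      set a := w (n + 1)
      set b := w n
      have : h / 2 * ((a - b) / h * ((a - b) / h)) + h * (a * a) + h * (b * b) + a ^ 2 - b ^ 2
          = h / 2 * ((a - b) / h + (a + b)) ^ 2 + h / 2 * (a - b) ^ 2 := by
        field_simp; ring
      have h2 : 0 ≤ h / 2 * ((a - b) / h + (a + b)) ^ 2 + h / 2 * (a - b) ^ 2 := by positivity
      linarith
  have hnat : ∀ n : ℕ, w n ^ 2 ≤ ip h K w w + gip h K w w := by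
    intro n
    rcases le_or_gt n (K + 1) with hn | hn
    · refine (key n hn).trans ?_
      have h1 : ∑ i ∈ Finset.Ico n (K + 1), (h / 2 * (((w (i + 1) - w i) / h)
            * ((w (i + 1) - w i) / h)) + h * (w (i + 1) * w (i + 1)) + h * (w i * w i))
          ≤ ∑ i ∈ Finset.range (K + 1), (h / 2 * (((w (i + 1) - w i) / h)
            * ((w (i + 1) - w i) / h)) + h * (w (i + 1) * w (i + 1)) + h * (w i * w i)) := by
        rw [Finset.range_eq_Ico]
        refine Finset.sum_le_sum_of_subset_of_nonneg (Finset.Ico_subset_Ico (Nat.zero_le _) le_rfl)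
          fun i _ _ => ?_
        have h1 := mul_self_nonneg ((w (i + 1) - w i) / h)
        have h2 := mul_self_nonneg (w (i + 1))
        have h3 := mul_self_nonneg (w i)
        positivity
      refine h1.trans ?_
      rw [Finset.sum_add_distrib, Finset.sum_add_distrib, ← Finset.mul_sum, ← Finset.mul_sum,
        ← Finset.mul_sum]
      have h2 : ∑ i ∈ Finset.range (K + 1), w (i + 1) * w (i + 1)
          = ∑ i ∈ Finset.range (K + 1), w i * w i - w 0 * w 0 := by
        have e1 := Finset.sum_range_succ (fun i : ℕ => w i * w i) (K + 1)
        have e2 := Finset.sum_range_succ' (fun i : ℕ => w i * w i) (K + 1)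
        have e3 : w ((K + 1 : ℕ) : ℤ) = 0 := hw _ (by rw [abs_of_nonneg] <;> lia)
        rw [e3] at e1
        push_cast at e1 e2 ⊢
        linarith
      rw [h2]
      have := gip_self_nonneg (K := K) hh w
      linarith
    · rw [hw _ (by rw [abs_of_nonneg] <;> lia)]
      have := gip_self_nonneg (K := K) hh w
      have := ip_self_nonneg (K := K) hh w
      simp; linarith
  rcases Int.natAbs_eq j with hj | hj
  · rw [hj]; exact hnat _
  · rw [hj, hwe]; exact hnat _

theorem nrm_abs {h : ℝ} {K : ℕ} (f : ℤ → ℝ) : nrm h K (fun j => |f j|) = nrm h K f := by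
  unfold nrm
  congr 1
  exact ip_congr fun j _ => abs_mul_abs_self _

theorem nrm_le_of_abs_le_five {h : ℝ} (hh : 0 < h) {K : ℕ} {f g₁ g₂ g₃ g₄ g₅ : ℤ → ℝ}
    {a₁ a₂ a₃ a₄ a₅ : ℝ} (h₁ : 0 ≤ a₁) (h₂ : 0 ≤ a₂) (h₃ : 0 ≤ a₃) (h₄ : 0 ≤ a₄) (h₅ : 0 ≤ a₅)
    (H : ∀ j : ℤ, |j| ≤ K →
      |f j| ≤ a₁ * |g₁ j| + a₂ * |g₂ j| + a₃ * |g₃ j| + a₄ * |g₄ j| + a₅ * |g₅ j|) :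
    nrm h K f ≤ a₁ * nrm h K g₁ + a₂ * nrm h K g₂ + a₃ * nrm h K g₃ + a₄ * nrm h K g₄
      + a₅ * nrm h K g₅ := by
  have key : ∀ {a : ℝ} (g : ℤ → ℝ), 0 ≤ a → nrm h K (fun j => a * |g j|) = a * nrm h K g :=
    fun g ha => by rw [nrm_const_mul, nrm_abs, abs_of_nonneg ha]
  have h0 := nrm_le_of_abs_le (h := h) (K := K) (f := f)
    (g := fun j => a₁ * |g₁ j| + a₂ * |g₂ j| + a₃ * |g₃ j| + a₄ * |g₄ j| + a₅ * |g₅ j|) hh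
    zero_le_one fun j hj => by rw [one_mul]; exact (H j hj).trans (le_abs_self _)
  rw [one_mul] at h0
  refine h0.trans ?_
  rw [← key g₁ h₁, ← key g₂ h₂, ← key g₃ h₃, ← key g₄ h₄, ← key g₅ h₅]
  refine (nrm_add_le hh _ _).trans (add_le_add_left ?_ _)
  refine (nrm_add_le hh _ _).trans (add_le_add_left ?_ _)
  refine (nrm_add_le hh _ _).trans (add_le_add_left ?_ _)
  exact nrm_add_le hh _ _

theorem sq_le_quarter {x : ℝ} (h1 : 0 ≤ x) (h2 : x ≤ 1 / 2) : x ^ 2 ≤ 1 / 4 := by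
  nlinarith

theorem nonlinear_error_le {u v ε : ℝ} (hε0 : 0 ≤ ε) (hε : ε ≤ 1 / 2) (h1 : 0 ≤ u) (h2 : u ≤ 1 / 2)
    (h3 : |v| ≤ ε) (β w : ℝ) :
    |β * (u + v) ^ 2 * (u + w) - u ^ 3 - 3 * u ^ 2 * w|
      ≤ |β - 1| * |u| + (|β - 1| + 2 * ε) * |w| + (1 / 2) * |w - v| + (ε / 2) * |v| := by
  have e1 : β * (u + v) ^ 2 * (u + w) - u ^ 3 - 3 * u ^ 2 * w = (β - 1) * ((u + v) ^ 2 * (u + w)) + -(2 * u ^ 2 * (w - v))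
      + 2 * u * v * w + v * u * v + v ^ 2 * w := by ring
  have huv : (u + v) ^ 2 ≤ 1 := by
    have := abs_le.1 h3
    rw [sq_le_one_iff_abs_le_one, abs_le]; constructor <;> linarith
  have h4 : |(β - 1) * ((u + v) ^ 2 * (u + w))| ≤ |β - 1| * (|u| + |w|) := by
    rw [abs_mul, abs_mul, abs_of_nonneg (sq_nonneg (u + v))]
    refine mul_le_mul_of_nonneg_left ?_ (abs_nonneg _)
    calc _ ≤ 1 * |u + w| := by gcongr
      _ ≤ _ := by rw [one_mul]; exact abs_add_le _ _
  have h5 : |-(2 * u ^ 2 * (w - v))| ≤ (1 / 2) * |w - v| := by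
    rw [abs_neg, abs_mul, abs_of_nonneg (by positivity)]
    gcongr
    nlinarith
  have h6 : |2 * u * v * w| ≤ ε * |w| := by
    rw [abs_mul, abs_mul, abs_of_nonneg (by positivity)]
    gcongr
    nlinarith [abs_nonneg (v)]
  have h7 : |v * u * v| ≤ (ε / 2) * |v| := by
    rw [abs_mul, abs_mul, abs_of_nonneg h1]
    gcongr
    nlinarith [abs_nonneg (v)]
  have h8 : |v ^ 2 * w| ≤ ε * |w| := by
    rw [abs_mul, abs_of_nonneg (sq_nonneg _)]
    gcongr
    rw [← sq_abs]
    nlinarith [abs_nonneg (v)]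
  rw [e1]
  have := abs_add_le ((β - 1) * ((u + v) ^ 2 * (u + w)) + -(2 * u ^ 2 * (w - v))
      + 2 * u * v * w + v * u * v) (v ^ 2 * w)
  have := abs_add_le ((β - 1) * ((u + v) ^ 2 * (u + w)) + -(2 * u ^ 2 * (w - v))
      + 2 * u * v * w) (v * u * v)
  have := abs_add_le ((β - 1) * ((u + v) ^ 2 * (u + w)) + -(2 * u ^ 2 * (w - v)))
      (2 * u * v * w)
  have := abs_add_le ((β - 1) * ((u + v) ^ 2 * (u + w))) (-(2 * u ^ 2 * (w - v)))
  linarith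

/-- The residual of `u` in the discrete stationary equation. -/
noncomputable def gsResidual (h : ℝ) (u : ℤ → ℝ) (j : ℤ) : ℝ :=
  (1 / 2) * dLap h u j + u j ^ 3 - u j / 8

/-- `u` is an approximate discrete ground state, up to an error `ρ`, with a coercive linearisation
on its orthogonal complement. -/
structure ApproxGround (h : ℝ) (K : ℕ) (u : ℤ → ℝ) (ρ : ℝ) : Prop where
  supp : SuppIn K u
  even : ∀ j, u (-j) = u j
  nonneg : ∀ j, 0 ≤ u j
  le_half : ∀ j, u j ≤ 1 / 2
  residual_le : nrm h K (gsResidual h u) ≤ ρ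
  mass : |ip h K u u - 1| ≤ ρ
  coercive : ∀ w, SuppIn K w → (∀ j, w (-j) = w j) → ip h K u w = 0 →
    (1 / 3000) * (ip h K w w + gip h K w w)
      ≤ (1 / 2) * gip h K w w + (1 / 8) * ip h K w w - 3 * ip h K (fun j => u j ^ 2 * w j) w

namespace ApproxGround

variable {h ρ : ℝ} {K : ℕ} {u : ℤ → ℝ}

theorem nrm_le (hu : ApproxGround h K u ρ) (hρ : ρ ≤ 1 / 100) :
    nrm h K u ≤ 11 / 10 := by
  have := (abs_le.1 hu.mass).2
  refine Real.sqrt_le_iff.2 ⟨by norm_num, by linarith⟩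

/-- One step of the scheme in projective coordinates around the approximate ground state. -/
structure Step (h : ℝ) (K : ℕ) (u : ℤ → ℝ) (τ ε : ℝ) (v w : ℤ → ℝ) (lam : ℝ) : Prop where
  supp_v : SuppIn K v
  supp_w : SuppIn K w
  even_w : ∀ j, w (-j) = w j
  orth_v : ip h K u v = 0
  orth_w : ip h K u w = 0
  abs_v : ∀ j, |v j| ≤ ε
  nrm_v : nrm h K v ≤ ε
  nrm_w : nrm h K w ≤ 4
  eqn : ∀ j : ℤ, |j| ≤ K → w j - v j = τ * ((1 / 2) * dLap h w j + (1 / 2) * dLap h u j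
    + 1 / (ip h K u u + ip h K v v) * (u j + v j) ^ 2 * (u j + w j) - lam * (u j + v j))

variable {τ ε lam : ℝ} {v w : ℤ → ℝ}

set_option maxHeartbeats 1000000 in
theorem step_estimate (hu : ApproxGround h K u ρ) (hh : 0 < h) (hτ : 0 < τ)
    (hε : ε ≤ 1 / 10000) (hρ : ρ ≤ ε) (hs : Step h K u τ ε v w lam) :
    ∃ e : ℝ, 0 ≤ e ∧
      e ≤ 13 * ρ + 48 * ε * nrm h K w + 3 * nrm h K (fun j => w j - v j) ∧
      nrm h K w ^ 2 - nrm h K v ^ 2 + nrm h K (fun j => w j - v j) ^ 2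
        ≤ 2 * τ * (-(1 / 3000) * (nrm h K w ^ 2 + gip h K w w) + e * nrm h K w) ∧
      nrm h K (fun j => w j - v j) ^ 2 ≤ -(τ / 4) * (gip h K w w - gip h K v v)
        + τ * (nrm h K w + e) * nrm h K (fun j => w j - v j) := by
  set V := nrm h K v with hV
  set W := nrm h K w with hW
  set d := nrm h K (fun j => w j - v j) with hd
  set U := nrm h K u with hU
  set s := ip h K u u with hsdef
  set β := 1 / (s + ip h K v v) with hβ
  have hV0 : 0 ≤ V := nrm_nonneg _
  have hW0 : 0 ≤ W := nrm_nonneg _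
  have hd0 : 0 ≤ d := nrm_nonneg _
  have hU0 : 0 ≤ U := nrm_nonneg _
  have hVε : V ≤ ε := hs.nrm_v
  have hW4 : W ≤ 4 := hs.nrm_w
  have hρ0 : 0 ≤ ρ := (abs_nonneg _).trans hu.mass
  have hε0 : 0 ≤ ε := hρ0.trans hρ
  have hU1 : U ≤ 11 / 10 := hu.nrm_le (by linarith)
  have hm := abs_le.1 hu.mass
  rw [← hsdef] at hm
  have hVV : ip h K v v = V ^ 2 := (nrm_sq hh v).symm
  have hWW : ip h K w w = W ^ 2 := (nrm_sq hh w).symm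
  have hdWV : d ≤ W + V := by
    have := nrm_add_le (K := K) hh w (fun j => (-1) * v j)
    rw [nrm_const_mul] at this
    simpa [← sub_eq_add_neg] using this
  have hVWd : V ≤ W + d := by
    have := nrm_add_le (K := K) hh w (fun j => (-1) * (w j - v j))
    rw [nrm_const_mul] at this
    simpa using this
  set b := |β - 1| with hb
  have hb0 : 0 ≤ b := abs_nonneg _
  have hV2 : V ^ 2 ≤ ε * V := by rw [pow_two]; gcongr
  have hb1 : b ≤ 2 * (ρ + ε * V) := by
    have hq : 0 < s + ip h K v v := by rw [hVV]; linarith [sq_nonneg V]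
    have : β - 1 = (1 - s - ip h K v v) / (s + ip h K v v) := by rw [hβ]; field_simp; ring
    rw [hb, this, abs_div, abs_of_pos hq, div_le_iff₀ hq, hVV]
    have h1 : |1 - s - V ^ 2| ≤ ρ + ε * V := by
      rw [abs_le]; constructor <;> linarith [sq_nonneg V]
    have h2 : 1 ≤ 2 * (s + V ^ 2) := by linarith [sq_nonneg V]
    have h3 : 0 ≤ ρ + ε * V := by positivity
    have := mul_le_mul_of_nonneg_left h2 h3
    linarith
  set e : ℤ → ℝ := fun j => β * (u j + v j) ^ 2 * (u j + w j) - u j ^ 3 - 3 * u j ^ 2 * w j with he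
  have hepw : ∀ j : ℤ, |e j| ≤ b * |u j| + (b + 2 * ε) * |w j| + (1 / 2) * |w j - v j|
      + (ε / 2) * |v j| := by
    intro j
    exact nonlinear_error_le hε0 (hε.trans (by norm_num)) (hu.nonneg j) (hu.le_half j) (hs.abs_v j) β (w j)
  have hbW : b * W ≤ 8 * ρ + ε * W := by
    have h1 : b * W ≤ (2 * (ρ + ε * V)) * W := by gcongr
    have h2 : ρ * W ≤ ρ * 4 := by gcongr
    have h3 : ε * V * W ≤ ε * ε * W := by gcongr
    have h4 : ε * ε * W ≤ (1 / 10000) * ε * W := by gcongr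
    have h5 := mul_nonneg hε0 hW0
    linarith
  have hbU : b * U ≤ (11 / 5) * (ρ + ε * V) := by
    have h1 : b * U ≤ (2 * (ρ + ε * V)) * (11 / 10) := by gcongr
    linarith
  have hne : nrm h K e ≤ 11 * ρ + 3 * ε * V + 3 * ε * W + (1 / 2) * d := by
    have := nrm_le_of_abs_le_five (h := h) (K := K) (f := e) (g₁ := u) (g₂ := w)
      (g₃ := fun j => w j - v j) (g₄ := v) (g₅ := v) (a₅ := 0) hh hb0
      (by positivity : 0 ≤ b + 2 * ε) (by norm_num : (0 : ℝ) ≤ 1 / 2)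
      (by positivity : 0 ≤ ε / 2) le_rfl fun j _ => (hepw j).trans_eq (by ring)
    have h1 := mul_nonneg hε0 hW0
    have h2 := mul_nonneg hε0 hV0
    linarith
  set r := gsResidual h u with hr
  have hrρ : nrm h K r ≤ ρ := hu.residual_le
  have hcomm := ip_dLap_comm hh hs.supp_w hu.supp
  have hwu : ip h K w u = 0 := by rw [ip_comm]; exact hs.orth_w
  have hvu : ip h K v u = 0 := by rw [ip_comm]; exact hs.orth_v
  have hlam : lam * s = ip h K r w + ip h K r u + s / 8 + 2 * ip h K (fun j => u j ^ 3) w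
      + ip h K e u := by
    have h1 : ip h K (fun j => w j - v j) u = 0 := by
      have : ip h K (fun j => w j - v j) u = ip h K w u - ip h K v u := by
        simp only [ip, Finset.mul_sum, ← Finset.sum_sub_distrib]
        exact Finset.sum_congr rfl fun j _ => by ring
      rw [this, hwu, hvu, sub_zero]
    have h2 : ip h K (fun j => w j - v j) u = τ * ((1 / 2) * ip h K (dLap h w) u
        + (1 / 2) * ip h K (dLap h u) u + ip h K (fun j => u j ^ 3) u
        + 3 * ip h K (fun j => u j ^ 3) w + ip h K e u - lam * (s + ip h K v u)) := by
      rw [ip_congr (f' := fun j => τ * ((1 / 2) * dLap h w j + (1 / 2) * dLap h u j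
        + β * (u j + v j) ^ 2 * (u j + w j) - lam * (u j + v j))) (g' := u)
        fun j hj => by rw [hs.eqn j hj]]
      simp only [hsdef, ip, Finset.mul_sum, ← Finset.sum_add_distrib, ← Finset.sum_sub_distrib]
      exact Finset.sum_congr rfl fun j _ => by simp only [he]; ring
    have h3 : ip h K r w = (1 / 2) * ip h K (dLap h u) w + ip h K (fun j => u j ^ 3) w
        - (1 / 8) * ip h K w u := by
      simp only [hr, gsResidual, ip, Finset.mul_sum, ← Finset.sum_add_distrib,
        ← Finset.sum_sub_distrib]
      exact Finset.sum_congr rfl fun j _ => by ring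
    have h4 : ip h K r u = (1 / 2) * ip h K (dLap h u) u + ip h K (fun j => u j ^ 3) u
        - (1 / 8) * s := by
      simp only [hsdef, hr, gsResidual, ip, Finset.mul_sum, ← Finset.sum_add_distrib,
        ← Finset.sum_sub_distrib]
      exact Finset.sum_congr rfl fun j _ => by ring
    rw [h1] at h2
    have h5 := (mul_eq_zero.1 h2.symm).resolve_left hτ.ne'
    rw [hwu] at h3
    rw [hvu] at h5
    linarith
  set l := |1 / 8 - lam| with hl
  have hl0 : 0 ≤ l := abs_nonneg _
  have hl1 : l ≤ 20 * (ρ + V + W) := by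
    have h1 : l * s = |ip h K r w + ip h K r u + 2 * ip h K (fun j => u j ^ 3) w
        + ip h K e u| := by
      have hs0 : 0 ≤ s := by linarith
      rw [hl, abs_sub_comm, ← abs_of_nonneg hs0, ← abs_mul]
      congr 1; linarith
    have h2 := abs_le.1 (abs_ip_le (K := K) hh r w)
    have h3 := abs_le.1 (abs_ip_le (K := K) hh r u)
    have h4 := abs_le.1 (abs_ip_le (K := K) hh (fun j => u j ^ 3) w)
    have h5 := abs_le.1 (abs_ip_le (K := K) hh e u)
    have h6 : nrm h K (fun j => u j ^ 3) ≤ 1 / 4 * U := by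
      refine nrm_le_of_abs_le hh (by norm_num) fun j _ => ?_
      have h1 := hu.nonneg j
      have h2 := hu.le_half j
      rw [abs_of_nonneg (by positivity), abs_of_nonneg h1]
      rw [pow_succ]
      exact mul_le_mul_of_nonneg_right (sq_le_quarter h1 h2) h1
    have h7 : nrm h K (fun j => u j ^ 3) * W ≤ (1 / 4 * (11 / 10)) * W := by gcongr; linarith
    have h8 : nrm h K r * W ≤ ρ * 4 := by gcongr
    have h9 : nrm h K r * U ≤ ρ * (11 / 10) := by gcongr
    have h10 : nrm h K e * U ≤ (11 * ρ + 3 * ε * V + 3 * ε * W + (1 / 2) * d) * (11 / 10) := by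
      gcongr
    have h11 : ε * V ≤ (1 / 10000) * V := by gcongr
    have h12 : ε * W ≤ (1 / 10000) * W := by gcongr
    have h13 : l * s ≤ 18 * (ρ + V + W) := by
      rw [h1, abs_le]; constructor <;> linarith [h2.1, h2.2, h3.1, h3.2, h4.1, h4.2, h5.1, h5.2]
    have h14 : l * (9 / 10) ≤ l * s := by gcongr; linarith
    linarith
  set E : ℤ → ℝ := fun j => r j + e j + (1 / 8) * (w j - v j) + (1 / 8 - lam) * v j with hE
  have hEn : nrm h K E ≤ 13 * ρ + 48 * ε * W + 3 * d := by
    have := nrm_le_of_abs_le_five (h := h) (K := K) (f := E) (g₁ := r) (g₂ := e)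
      (g₃ := fun j => w j - v j) (g₄ := v) (g₅ := v) (a₁ := 1) (a₂ := 1) (a₃ := 1 / 8) (a₄ := l)
      (a₅ := 0) hh (by norm_num) (by norm_num) (by norm_num) hl0 le_rfl fun j _ => by
        simp only [hE]
        have h1 := abs_add_le (r j + e j + (1 / 8) * (w j - v j)) ((1 / 8 - lam) * v j)
        have h2 := abs_add_le (r j + e j) ((1 / 8) * (w j - v j))
        have h3 := abs_add_le (r j) (e j)
        rw [abs_mul] at h1 h2
        have h4 : |(1 / 8 : ℝ)| = 1 / 8 := by norm_num
        rw [h4] at h2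
        linarith
    have h1 : l * V ≤ 20 * (ρ + V + W) * ε := by gcongr
    have h2 : ε * V ≤ ε * (W + d) := by gcongr
    have h3 : ε * d ≤ (1 / 10000) * d := by gcongr
    have h4 : ε * ρ ≤ (1 / 10000) * ρ := by gcongr
    have h5 := mul_nonneg hε0 hW0
    linarith
  have heq : ∀ j : ℤ, |j| ≤ K → w j - v j = τ * ((1 / 2) * dLap h w j + 3 * u j ^ 2 * w j
      - (1 / 8) * w j + E j + (1 / 8 - lam) * u j) := fun j hj => by
    rw [hs.eqn j hj]
    simp only [hE, he, hr, gsResidual]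
    have := hs.eqn j hj
    ring
  have hEw := ip_le (K := K) hh E w
  have hLw := ip_dLap hh w hs.supp_w
  refine ⟨nrm h K E, nrm_nonneg _, hEn, ?_, ?_⟩
  · have h1 : W ^ 2 - V ^ 2 + d ^ 2 = 2 * ip h K (fun j => w j - v j) w := by
      rw [hW, hV, hd, nrm_sq hh, nrm_sq hh, nrm_sq hh]
      simp only [ip, Finset.mul_sum, ← Finset.sum_add_distrib, ← Finset.sum_sub_distrib]
      exact Finset.sum_congr rfl fun j _ => by ring
    have h2 : ip h K (fun j => w j - v j) w = τ * ((1 / 2) * ip h K (dLap h w) w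
        + 3 * ip h K (fun j => u j ^ 2 * w j) w - (1 / 8) * ip h K w w + ip h K E w
        + (1 / 8 - lam) * ip h K u w) := by
      rw [ip_congr (f' := fun j => τ * ((1 / 2) * dLap h w j + 3 * u j ^ 2 * w j
        - (1 / 8) * w j + E j + (1 / 8 - lam) * u j)) (g' := w) fun j hj => by rw [heq j hj]]
      simp only [ip, Finset.mul_sum, ← Finset.sum_add_distrib, ← Finset.sum_sub_distrib]
      exact Finset.sum_congr rfl fun j _ => by ring
    have h3 := hu.coercive w hs.supp_w hs.even_w hs.orth_w
    have h4 := mul_le_mul_of_nonneg_left h3 hτ.le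
    have h5 := mul_le_mul_of_nonneg_left hEw hτ.le
    rw [h1, h2, hLw, hs.orth_w, ← hWW]
    linarith
  · set D : ℤ → ℝ := fun j => w j - v j with hD
    have hDs : SuppIn K D := fun j hj => by simp [hD, hs.supp_w j hj, hs.supp_v j hj]
    have h1 : d ^ 2 = τ * ((1 / 2) * ip h K (dLap h w) D
        + ip h K (fun j => 3 * u j ^ 2 * w j - (1 / 8) * w j) D + ip h K E D
        + (1 / 8 - lam) * ip h K u D) := by
      rw [hd, nrm_sq hh]
      rw [ip_congr (f' := fun j => τ * ((1 / 2) * dLap h w j + 3 * u j ^ 2 * w j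
        - (1 / 8) * w j + E j + (1 / 8 - lam) * u j)) (g' := D) fun j hj => by rw [← heq j hj]]
      simp only [ip, Finset.mul_sum, ← Finset.sum_add_distrib]
      exact Finset.sum_congr rfl fun j _ => by ring
    have h2 : ip h K u D = 0 := by
      have : ip h K u D = ip h K u w - ip h K u v := by
        simp only [hD, ip, Finset.mul_sum, ← Finset.sum_sub_distrib]
        exact Finset.sum_congr rfl fun j _ => by ring
      rw [this, hs.orth_w, hs.orth_v, sub_zero]
    have h3 : gip h K w D = (1 / 2) * (gip h K w w - gip h K v v + gip h K D D) := by
      simp only [hD, gip, Finset.mul_sum, ← Finset.sum_add_distrib, ← Finset.sum_sub_distrib]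
      exact Finset.sum_congr rfl fun j _ => by ring
    have h4 : nrm h K (fun j => 3 * u j ^ 2 * w j - (1 / 8) * w j) ≤ 1 * W := by
      refine nrm_le_of_abs_le hh zero_le_one fun j _ => ?_
      have h1 := hu.nonneg j
      have h2 := hu.le_half j
      have : 3 * u j ^ 2 * w j - (1 / 8) * w j = (3 * u j ^ 2 - 1 / 8) * w j := by ring
      rw [this, abs_mul]
      gcongr
      have := sq_le_quarter h1 h2
      rw [abs_le]; constructor <;> linarith [sq_nonneg (u j)]
    have h5 := ip_le (K := K) hh (fun j => 3 * u j ^ 2 * w j - (1 / 8) * w j) D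
    have h6 := ip_le (K := K) hh E D
    have h7 : nrm h K (fun j => 3 * u j ^ 2 * w j - (1 / 8) * w j) * d ≤ (1 * W) * d := by gcongr
    have h8 := gip_self_nonneg (K := K) hh D
    have h9 := mul_le_mul_of_nonneg_left (h5.trans h7) hτ.le
    have h10 := mul_le_mul_of_nonneg_left h6 hτ.le
    have h11 := mul_nonneg hτ.le h8
    rw [h1, h2, ip_dLap hh w hDs, h3]
    linarith

end ApproxGround

theorem lyapunov_of_step_estimates {V W d P Pv ρ ε τ e : ℝ} (hW : 0 ≤ W) (hd : 0 ≤ d)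
    (hP : 0 ≤ P) (hε : ε ≤ 1 / 2000000) (hτ : 0 < τ)
    (hτ1 : τ ≤ 1 / 1000000) (he : e ≤ 13 * ρ + 48 * ε * W + 3 * d)
    (h1 : W ^ 2 - V ^ 2 + d ^ 2 ≤ 2 * τ * (-(1 / 3000) * (W ^ 2 + P) + e * W))
    (h2 : d ^ 2 ≤ -(τ / 4) * (P - Pv) + τ * (W + e) * d) :
    (96000 * W ^ 2 + P) * (1 + τ / 6000) ≤ 96000 * V ^ 2 + Pv + 10 ^ 11 * τ * ρ ^ 2 := by
  have hεW : ε * W ^ 2 ≤ (1 / 2000000) * W ^ 2 := by gcongr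
  have h3 : e * W ≤ 13 * (ρ * W) + 48 * (ε * W ^ 2) + 3 * (d * W) := by
    have := mul_le_mul_of_nonneg_right he hW
    linarith
  have h4 : 26 * (ρ * W) ≤ (1 / 6000) * W ^ 2 + 1014000 * ρ ^ 2 := by
    nlinarith [sq_nonneg ((1 / 6000) * W - 13 * ρ)]
  have h5 : 6 * τ * (d * W) ≤ d ^ 2 + 9 * τ ^ 2 * W ^ 2 := by nlinarith [sq_nonneg (d - 3 * τ * W)]
  have h6 : τ ^ 2 * W ^ 2 ≤ (1 / 1000000) * τ * W ^ 2 := by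
    have : τ ^ 2 ≤ (1 / 1000000) * τ := by rw [pow_two]; gcongr
    gcongr
  have key1 : W ^ 2 - V ^ 2 ≤ τ * (-(1 / 3000) * (W ^ 2 + P) + 1014000 * ρ ^ 2) := by
    have a1 := mul_le_mul_of_nonneg_left h3 hτ.le
    have a2 := mul_le_mul_of_nonneg_left h4 hτ.le
    have a3 := mul_le_mul_of_nonneg_left hεW hτ.le
    have a4 := mul_nonneg hτ.le (sq_nonneg W)
    have a5 := mul_nonneg hτ.le hP
    linarith
  have h7 : e * d ≤ 13 * (ρ * d) + W * d + 3 * d ^ 2 := by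
    have a1 := mul_le_mul_of_nonneg_right he hd
    have a2 : ε * (W * d) ≤ (1 / 2000000) * (W * d) := by gcongr
    have a3 := mul_nonneg hW hd
    linarith
  have key2 : P - Pv ≤ 16 * τ * W ^ 2 + 600 * τ * ρ ^ 2 := by
    have a0 := mul_le_mul_of_nonneg_left h7 hτ.le
    have a1 : τ * d ^ 2 ≤ (1 / 1000000) * d ^ 2 := by gcongr
    have a2 : 2 * τ * (W * d) ≤ (1 / 3) * d ^ 2 + 3 * τ ^ 2 * W ^ 2 := by
      nlinarith [sq_nonneg ((1 / 3) * d - τ * W)]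
    have a3 : 13 * τ * (ρ * d) ≤ (1 / 3) * d ^ 2 + 127 * τ ^ 2 * ρ ^ 2 := by
      nlinarith [sq_nonneg ((1 / 3) * d - (13 / 2) * τ * ρ), sq_nonneg (τ * ρ)]
    have a4 : (τ / 4) * (P - Pv) ≤ 3 * τ ^ 2 * W ^ 2 + 127 * τ ^ 2 * ρ ^ 2 := by
      linarith [sq_nonneg d]
    have a5 : τ * (P - Pv) ≤ τ * (12 * τ * W ^ 2 + 508 * τ * ρ ^ 2) := by linarith
    have a6 := le_of_mul_le_mul_left a5 hτ
    have a7 := mul_nonneg hτ.le (sq_nonneg W)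
    have a8 := mul_nonneg hτ.le (sq_nonneg ρ)
    linarith
  have b1 := mul_nonneg hτ.le (sq_nonneg W)
  have b2 := mul_nonneg hτ.le (sq_nonneg ρ)
  have b3 := mul_nonneg hτ.le hP
  linarith

/-- The Lyapunov functional of the scheme. -/
noncomputable def lyap (h : ℝ) (K : ℕ) (v : ℤ → ℝ) : ℝ := 96000 * ip h K v v + gip h K v v

theorem ApproxGround.step_lyap_le {h ρ τ ε lam : ℝ} {K : ℕ} {u v w : ℤ → ℝ}
    (hu : ApproxGround h K u ρ) (hh : 0 < h) (hτ : 0 < τ) (hτ1 : τ ≤ 1 / 1000000)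
    (hε : ε ≤ 1 / 2000000) (hρ : ρ ≤ ε) (hs : ApproxGround.Step h K u τ ε v w lam) :
    lyap h K w * (1 + τ / 6000) ≤ lyap h K v + 10 ^ 11 * τ * ρ ^ 2 := by
  obtain ⟨e, _, he1, he2, he3⟩ := hu.step_estimate hh hτ (by linarith) hρ hs
  unfold lyap
  rw [← nrm_sq hh, ← nrm_sq hh]
  exact lyapunov_of_step_estimates (nrm_nonneg _) (nrm_nonneg _) (gip_self_nonneg hh w)
    hε hτ hτ1 he1 he2 he3

/-- `φ` solves the linearly implicit system with datum `ψ`. -/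
def ImplicitStep (h : ℝ) (K : ℕ) (τ : ℝ) (ψ φ : ℤ → ℝ) : Prop :=
  SuppIn K φ ∧ ∀ ℓ : ℤ, |ℓ| ≤ (K : ℤ) →
    φ ℓ = ψ ℓ + τ * ((1 / 2) * dLap h φ ℓ + (ψ ℓ) ^ 2 * φ ℓ)

section ImplicitStep

variable {h τ : ℝ} {K : ℕ} {ψ φ φ₁ φ₂ : ℤ → ℝ}

theorem ip_sq_mul_le (hh : 0 < h) (hψ : ∀ j, |ψ j| ≤ 1) (φ : ℤ → ℝ) :
    ip h K (fun j => ψ j ^ 2 * φ j) φ ≤ ip h K φ φ := by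
  unfold ip
  refine mul_le_mul_of_nonneg_left (Finset.sum_le_sum fun j _ => ?_) hh.le
  rw [mul_assoc]
  exact mul_le_of_le_one_left (mul_self_nonneg _) ((sq_le_one_iff_abs_le_one _).2 (hψ j))

theorem implicit_kernel_trivial (hh : 0 < h) (hτ : 0 < τ) (hτ1 : τ ≤ 1 / 2) (hψ : ∀ j, |ψ j| ≤ 1)
    (hφ : SuppIn K φ)
    (H : ∀ ℓ : ℤ, |ℓ| ≤ (K : ℤ) → φ ℓ = τ * ((1 / 2) * dLap h φ ℓ + (ψ ℓ) ^ 2 * φ ℓ)) :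
    ∀ ℓ, φ ℓ = 0 := by
  have h1 : ip h K φ φ = τ * ((1 / 2) * ip h K (dLap h φ) φ
      + ip h K (fun j => ψ j ^ 2 * φ j) φ) := by
    have : ip h K φ φ
        = ip h K (fun ℓ => τ * ((1 / 2) * dLap h φ ℓ + (ψ ℓ) ^ 2 * φ ℓ)) φ :=
      ip_congr fun j hj => by rw [← H j hj]
    rw [this]
    simp only [ip, Finset.mul_sum, ← Finset.sum_add_distrib]
    exact Finset.sum_congr rfl fun j _ => by ring
  rw [ip_dLap hh φ hφ] at h1
  have h2 := mul_le_mul_of_nonneg_left (ip_sq_mul_le (K := K) hh hψ φ) hτ.le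
  have h3 := mul_nonneg hτ.le (gip_self_nonneg (K := K) hh φ)
  have h4 := ip_self_nonneg (K := K) hh φ
  have h5 := mul_le_mul_of_nonneg_right hτ1 h4
  have h0 : ip h K φ φ = 0 := by linarith
  intro ℓ
  by_cases hℓ : |ℓ| ≤ K
  · unfold ip at h0
    have h6 := (mul_eq_zero.1 h0).resolve_left hh.ne'
    rw [Finset.sum_eq_zero_iff_of_nonneg fun _ _ => mul_self_nonneg _] at h6
    exact mul_self_eq_zero.1 (h6 ℓ (Finset.mem_Icc.2 (abs_le.1 hℓ)))
  · exact hφ ℓ (not_le.1 hℓ)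

theorem ImplicitStep.unique (hh : 0 < h) (hτ : 0 < τ) (hτ1 : τ ≤ 1 / 2) (hψ : ∀ j, |ψ j| ≤ 1)
    (h₁ : ImplicitStep h K τ ψ φ₁) (h₂ : ImplicitStep h K τ ψ φ₂) : φ₁ = φ₂ := by
  ext ℓ
  have := implicit_kernel_trivial (φ := fun j => φ₁ j - φ₂ j) hh hτ hτ1 hψ
    (fun j hj => by simp [h₁.1 j hj, h₂.1 j hj]) (fun j hj => by
      have e1 := h₁.2 j hj
      have e2 := h₂.2 j hj
      unfold dLap at e1 e2 ⊢
      linear_combination e1 - e2) ℓ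
  exact sub_eq_zero.1 this

theorem ImplicitStep.even (hh : 0 < h) (hτ : 0 < τ) (hτ1 : τ ≤ 1 / 2) (hψ : ∀ j, |ψ j| ≤ 1)
    (hψe : ∀ j, ψ (-j) = ψ j) (H : ImplicitStep h K τ ψ φ) (j : ℤ) : φ (-j) = φ j := by
  have : ImplicitStep h K τ ψ (fun j => φ (-j)) := by
    refine ⟨fun j hj => H.1 _ (by rwa [abs_neg]), fun j hj => ?_⟩
    have e := H.2 (-j) (by rwa [abs_neg])
    rw [hψe] at e
    unfold dLap at e ⊢
    beta_reduce
    have e1 : -(j + 1) = -j - 1 := by ring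
    have e2 : -(j - 1) = -j + 1 := by ring
    rw [e1, e2]
    linear_combination e
  exact congrFun (this.unique hh hτ hτ1 hψ H) j

/-- Extension by zero. -/
noncomputable def extZero (K : ℕ) : (Finset.Icc (-(K : ℤ)) K → ℝ) →ₗ[ℝ] (ℤ → ℝ) where
  toFun x j := if hj : j ∈ Finset.Icc (-(K : ℤ)) K then x ⟨j, hj⟩ else 0
  map_add' x y := by ext j; simp only [Pi.add_apply]; split_ifs <;> simp
  map_smul' c x := by
    ext j; simp only [Pi.smul_apply, RingHom.id_apply]; split_ifs <;> simp

theorem suppIn_extZero (x : Finset.Icc (-(K : ℤ)) K → ℝ) : SuppIn K (extZero K x) := by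
  intro j hj
  refine dif_neg fun hc => ?_
  exact absurd (abs_le.2 (Finset.mem_Icc.1 hc)) (not_le.2 hj)

theorem extZero_apply (x : Finset.Icc (-(K : ℤ)) K → ℝ) (i : Finset.Icc (-(K : ℤ)) K) :
    extZero K x i = x i := dif_pos i.2

theorem exists_implicitStep (hh : 0 < h) (hτ : 0 < τ) (hτ1 : τ ≤ 1 / 2) (hψ : ∀ j, |ψ j| ≤ 1) :
    ∃ φ, ImplicitStep h K τ ψ φ := by
  let T : (Finset.Icc (-(K : ℤ)) K → ℝ) →ₗ[ℝ] (Finset.Icc (-(K : ℤ)) K → ℝ) :=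
    { toFun := fun x i => extZero K x i - τ * ((1 / 2) * dLap h (extZero K x) i
        + (ψ i) ^ 2 * extZero K x i)
      map_add' := fun x y => by
        ext i
        simp only [map_add, Pi.add_apply, dLap]
        ring
      map_smul' := fun c x => by
        ext i
        simp only [map_smul, Pi.smul_apply, smul_eq_mul, dLap, RingHom.id_apply]
        ring }
  have hinj : Function.Injective T := by
    rw [← LinearMap.ker_eq_bot, LinearMap.ker_eq_bot']
    intro x hx
    have := implicit_kernel_trivial hh hτ hτ1 hψ (suppIn_extZero x) fun j hj => by
      have := congrFun hx ⟨j, Finset.mem_Icc.2 (abs_le.1 hj)⟩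
      exact sub_eq_zero.1 this
    ext i
    rw [← extZero_apply x i]
    exact this i
  obtain ⟨x, hx⟩ := LinearMap.injective_iff_surjective.1 hinj fun i => ψ i
  refine ⟨extZero K x, suppIn_extZero x, fun j hj => ?_⟩
  have := congrFun hx ⟨j, Finset.mem_Icc.2 (abs_le.1 hj)⟩
  exact sub_eq_iff_eq_add.1 this

theorem ImplicitStep.nrm_le (hh : 0 < h) (hτ : 0 < τ) (hτ1 : τ ≤ 1 / 2) (hψ : ∀ j, |ψ j| ≤ 1)
    (H : ImplicitStep h K τ ψ φ) : nrm h K φ ≤ 2 * nrm h K ψ := by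
  have h1 : ip h K φ φ = ip h K ψ φ + τ * ((1 / 2) * ip h K (dLap h φ) φ
      + ip h K (fun j => ψ j ^ 2 * φ j) φ) := by
    have : ip h K φ φ
        = ip h K (fun ℓ => ψ ℓ + τ * ((1 / 2) * dLap h φ ℓ + (ψ ℓ) ^ 2 * φ ℓ)) φ :=
      ip_congr fun j hj => by rw [← H.2 j hj]
    rw [this]
    simp only [ip, Finset.mul_sum, ← Finset.sum_add_distrib]
    exact Finset.sum_congr rfl fun j _ => by ring
  rw [ip_dLap hh φ H.1] at h1
  have h2 := mul_le_mul_of_nonneg_left (ip_sq_mul_le (K := K) hh hψ φ) hτ.le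
  have h3 := mul_nonneg hτ.le (gip_self_nonneg (K := K) hh φ)
  have h5 := mul_le_mul_of_nonneg_right hτ1 (ip_self_nonneg (K := K) hh φ)
  have h6 := ip_le (K := K) hh ψ φ
  exact nrm_le_of_ip_le hh (mul_nonneg zero_le_two (nrm_nonneg _)) (by linarith)

end ImplicitStep

/-- `ψ` is the normalisation of `u + v`, where `v` is even, supported in `[-K, K]` and orthogonal
to `u`. -/
structure IsProjective (h : ℝ) (K : ℕ) (u v ψ : ℤ → ℝ) : Prop where
  supp : SuppIn K v
  even : ∀ j, v (-j) = v j
  orth : ip h K u v = 0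
  eq : ∀ j, ψ j = (u j + v j) / Real.sqrt (ip h K u u + ip h K v v)

namespace IsProjective

variable {h ρ ε τ : ℝ} {K : ℕ} {u v ψ φ : ℤ → ℝ}

theorem lyap_bounds (hp : IsProjective h K u v ψ) (hh : 0 < h) (hε : 0 ≤ ε)
    (hv : lyap h K v ≤ ε ^ 2) : (∀ j, |v j| ≤ ε) ∧ ip h K v v ≤ ε ^ 2 := by
  have h1 := ip_self_nonneg (K := K) hh v
  have h2 := gip_self_nonneg (K := K) hh v
  unfold lyap at hv
  exact ⟨fun j => abs_le_of_sq_le_sq (by linarith [sq_le_ip_add_gip hh hp.supp hp.even j]) hε,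
    by linarith⟩

theorem factor_bounds (hu : ApproxGround h K u ρ) (hh : 0 < h)
    (hρ : ρ ≤ 1 / 2000000) (hv : ip h K v v ≤ 1 / 2000000) :
    ∃ α : ℝ, 0.99 ≤ α ∧ α ≤ 1.01 ∧ α ^ 2 * (ip h K u u + ip h K v v) = 1 ∧
      α = 1 / Real.sqrt (ip h K u u + ip h K v v) := by
  have h1 := abs_le.1 hu.mass
  have h2 := ip_self_nonneg (K := K) hh v
  have hm : 0 < ip h K u u + ip h K v v := by linarith
  have h3 := Real.sqrt_pos.2 hm
  have h4 := Real.sq_sqrt hm.le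
  refine ⟨_, ?_, ?_, ?_, rfl⟩
  · rw [le_div_iff₀ h3]
    have : Real.sqrt (ip h K u u + ip h K v v) ≤ 1.01 :=
      Real.sqrt_le_iff.2 ⟨by norm_num, by norm_num; linarith⟩
    linarith
  · rw [div_le_iff₀ h3]
    have : 0.995 ≤ Real.sqrt (ip h K u u + ip h K v v) :=
      Real.le_sqrt_of_sq_le (by norm_num; linarith)
    linarith
  · rw [div_pow, h4, one_pow, one_div_mul_cancel hm.ne']

theorem abs_le_one (hp : IsProjective h K u v ψ) (hu : ApproxGround h K u ρ) (hh : 0 < h)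
    (hε : 0 ≤ ε) (hε1 : ε ≤ 1 / 2000000) (hρ : ρ ≤ ε) (hv : lyap h K v ≤ ε ^ 2) (j : ℤ) :
    |ψ j| ≤ 1 := by
  obtain ⟨h1, h2⟩ := hp.lyap_bounds hh hε hv
  obtain ⟨α, h3, h4, -, h5⟩ := factor_bounds (v := v) hu hh (by linarith) (by nlinarith)
  rw [hp.eq, div_eq_mul_one_div, ← h5, abs_mul, abs_of_pos (by linarith : 0 < α)]
  have h6 : |u j + v j| ≤ 0.6 := by
    have := abs_le.1 (h1 j)
    have := hu.nonneg j
    have := hu.le_half j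
    rw [abs_le]; constructor <;> linarith
  nlinarith [abs_nonneg (u j + v j)]

theorem nrm_potential_le (hu : ApproxGround h K u ρ) (hh : 0 < h) (hρ : ρ ≤ 1 / 100)
    (hψ : ∀ j, |ψ j| ≤ 1) : nrm h K (fun j => (1 / 2) * dLap h u j + ψ j ^ 2 * u j) ≤ 3 := by
  have h1 : nrm h K (fun j => (1 / 2) * dLap h u j + ψ j ^ 2 * u j)
      ≤ nrm h K (gsResidual h u) + nrm h K (fun j => (1 / 8 + ψ j ^ 2 - u j ^ 2) * u j) := by
    have := nrm_add_le (K := K) hh (gsResidual h u) (fun j => (1 / 8 + ψ j ^ 2 - u j ^ 2) * u j)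
    refine le_of_eq_of_le ?_ this
    congr 1
    ext j
    unfold gsResidual
    ring
  have h2 : nrm h K (fun j => (1 / 8 + ψ j ^ 2 - u j ^ 2) * u j) ≤ 2 * nrm h K u := by
    refine nrm_le_of_abs_le hh zero_le_two fun j _ => ?_
    rw [abs_mul]
    refine mul_le_mul_of_nonneg_right ?_ (abs_nonneg _)
    have h3 := (sq_le_one_iff_abs_le_one _).2 (hψ j)
    have h4 := sq_le_quarter (hu.nonneg j) (hu.le_half j)
    rw [abs_le]
    constructor <;> nlinarith [sq_nonneg (ψ j), sq_nonneg (u j)]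
  have := hu.nrm_le hρ
  have := hu.residual_le
  linarith

theorem ip_self_eq_one (hp : IsProjective h K u v ψ) {α : ℝ}
    (hα : α ^ 2 * (ip h K u u + ip h K v v) = 1)
    (hα' : α = 1 / Real.sqrt (ip h K u u + ip h K v v)) : ip h K ψ ψ = 1 := by
  have : ip h K ψ ψ
      = α ^ 2 * (ip h K u u + ip h K v v) + 2 * α ^ 2 * ip h K u v := by
    simp only [ip, Finset.mul_sum, ← Finset.sum_add_distrib, mul_add]
    refine Finset.sum_congr rfl fun j _ => ?_
    rw [hp.eq, div_eq_mul_one_div, ← hα']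
    ring
  rw [this, hα, hp.orth]; ring

theorem step (hp : IsProjective h K u v ψ) (hu : ApproxGround h K u ρ) (hh : 0 < h)
    (hε : 0 ≤ ε) (hε1 : ε ≤ 1 / 2000000) (hρ : ρ ≤ ε) (hτ : 0 < τ) (hτ1 : τ ≤ 1 / 1000000)
    (hv : lyap h K v ≤ ε ^ 2) (hφ : ImplicitStep h K τ ψ φ) :
    0 < ip h K φ φ ∧ ∃ w, IsProjective h K u w (fun j => φ j / Real.sqrt (ip h K φ φ)) ∧
      lyap h K w * (1 + τ / 6000) ≤ lyap h K v + 10 ^ 11 * τ * ρ ^ 2 := by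
  obtain ⟨hv1, hv2⟩ := hp.lyap_bounds hh hε hv
  have hψ1 := hp.abs_le_one hu hh hε hε1 hρ hv
  obtain ⟨α, hα1, hα2, hα3, hα4⟩ := factor_bounds (v := v) hu hh (by linarith) (by nlinarith)
  have hψ : ∀ j, ψ j = α * (u j + v j) := fun j => by
    rw [hp.eq, div_eq_mul_one_div, ← hα4, mul_comm]
  have hψψ := hp.ip_self_eq_one hα3 hα4
  have hnψ : nrm h K ψ = 1 := by rw [nrm, hψψ, Real.sqrt_one]
  have hnφ : nrm h K φ ≤ 2 := by
    have := hφ.nrm_le hh hτ (by linarith) hψ1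
    linarith
  have hm := abs_le.1 hu.mass
  set s := ip h K u u with hs
  have e1 : ip h K u φ = α * s + τ * ip h K φ (fun j => (1 / 2) * dLap h u j + ψ j ^ 2 * u j) := by
    have h1 : ip h K u φ
        = ip h K u (fun ℓ => ψ ℓ + τ * ((1 / 2) * dLap h φ ℓ + (ψ ℓ) ^ 2 * φ ℓ)) :=
      ip_congr fun j hj => by rw [← hφ.2 j hj]
    have h2 : ip h K u (fun ℓ => ψ ℓ + τ * ((1 / 2) * dLap h φ ℓ + (ψ ℓ) ^ 2 * φ ℓ))
        = α * s + α * ip h K u v + τ * ((1 / 2) * ip h K (dLap h φ) u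
          + ip h K φ (fun j => ψ j ^ 2 * u j)) := by
      simp only [hs, ip, Finset.mul_sum, ← Finset.sum_add_distrib]
      exact Finset.sum_congr rfl fun j _ => by rw [hψ]; ring
    rw [h1, h2, hp.orth, ip_dLap_comm hh hφ.1 hu.supp]
    simp only [ip, Finset.mul_sum, mul_zero, add_zero, ← Finset.sum_add_distrib]
    congr 1
    exact Finset.sum_congr rfl fun j _ => by ring
  have h3 : |ip h K φ (fun j => (1 / 2) * dLap h u j + ψ j ^ 2 * u j)| ≤ 6 := by
    refine (abs_ip_le hh _ _).trans ?_
    calc _ ≤ (2 : ℝ) * 3 := mul_le_mul hnφ (nrm_potential_le hu hh (by linarith) hψ1)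
          (nrm_nonneg _) zero_le_two
      _ = 6 := by norm_num
  have hs0 : 0 < s := by linarith
  obtain ⟨g, hg⟩ : ∃ g, ip h K u φ = g * s := ⟨ip h K u φ / s, by field_simp⟩
  have hg1 : 3 / 5 ≤ g := by
    have h4 := (abs_le.1 h3).1
    have h5 := mul_le_mul_of_nonneg_left h4 hτ.le
    have h6 := mul_le_mul_of_nonneg_right hα1 hs0.le
    by_contra hc
    have h7 := mul_le_mul_of_nonneg_right (not_le.1 hc).le hs0.le
    linarith
  have hg0 : 0 < g := by linarith
  let w : ℤ → ℝ := fun j => φ j / g - u j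
  have hφw : ∀ j, φ j = g * (u j + w j) := fun j => by
    simp only [w]; field_simp; ring
  have horth : ip h K u w = 0 := by
    have : ip h K u w = 1 / g * ip h K u φ - ip h K u u := by
      simp only [ip, Finset.mul_sum, ← Finset.sum_sub_distrib]
      exact Finset.sum_congr rfl fun j _ => by simp only [w]; ring
    rw [this, hg]; field_simp; linarith
  have hφφ : ip h K φ φ = g ^ 2 * (s + ip h K w w) := by
    have : ip h K φ φ = g ^ 2 * (s + ip h K w w) + 2 * g ^ 2 * ip h K u w := by
      simp only [hs, ip, Finset.mul_sum, ← Finset.sum_add_distrib, mul_add]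
      exact Finset.sum_congr rfl fun j _ => by rw [hφw]; ring
    rw [this, horth]; ring
  have hw0 := ip_self_nonneg (K := K) hh w
  have hwsupp : SuppIn K w := fun j hj => by simp only [w, hφ.1 j hj, hu.supp j hj]; simp
  have hψe : ∀ j, ψ (-j) = ψ j := fun j => by rw [hψ, hψ, hu.even, hp.even]
  have hweven : ∀ j, w (-j) = w j := fun j => by
    simp only [w, hu.even, hφ.even hh hτ (by linarith) hψ1 hψe]
  have hw4 : nrm h K w ≤ 4 := by
    refine Real.sqrt_le_iff.2 ⟨by norm_num, ?_⟩
    have h4 : ip h K φ φ ≤ 4 := by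
      rw [← nrm_sq hh]
      nlinarith [nrm_nonneg (h := h) (K := K) φ]
    have h5 : (3 / 5) ^ 2 * (s + ip h K w w) ≤ g ^ 2 * (s + ip h K w w) := by gcongr
    linarith
  refine ⟨by rw [hφφ]; positivity, w, ⟨hwsupp, hweven, horth, fun j => ?_⟩, ?_⟩
  · rw [hφφ, Real.sqrt_mul (sq_nonneg g), Real.sqrt_sq hg0.le, hφw, mul_div_mul_left _ _ hg0.ne']
  · refine hu.step_lyap_le (lam := (1 - α / g) / τ) hh hτ hτ1 hε1 hρ ⟨hp.supp, hwsupp, hweven,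
      hp.orth, horth, hv1, Real.sqrt_le_iff.2 ⟨hε, hv2⟩, hw4, fun j hj => ?_⟩
    have h4 := hφ.2 j hj
    have h5 : dLap h φ j = g * (dLap h u j + dLap h w j) := by
      unfold dLap; rw [hφw, hφw, hφw]; ring
    have h6 : 1 / (ip h K u u + ip h K v v) = α ^ 2 := by
      rw [hα4, div_pow, Real.sq_sqrt (by linarith [ip_self_nonneg (K := K) hh v]), one_pow]
    rw [h5, hφw, hψ] at h4
    rw [h6]
    clear_value w
    field_simp
    linear_combination 2 * h4

end IsProjective

theorem Nh_eq_ip {h : ℝ} {K : ℕ} {f : ℤ → ℝ} (hf : SuppIn K f) : Nh h f = ip h K f f := by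
  unfold Nh ip
  congr 1
  rw [tsum_eq_sum (s := Finset.Icc (-(K : ℤ)) K)]
  · exact Finset.sum_congr rfl fun j _ => pow_two _
  · intro j hj
    rw [hf j (not_le.1 fun hc => hj (Finset.mem_Icc.2 (abs_le.1 hc))), zero_pow two_ne_zero]

section Scheme

variable {h ρ ε τ : ℝ} {K : ℕ} {u v₀ ψ₀ : ℤ → ℝ}

theorem exists_scheme (hu : ApproxGround h K u ρ) (hh : 0 < h) (hε : 0 ≤ ε)
    (hε1 : ε ≤ 1 / 2000000) (hρ : ρ ≤ ε) (hρ2 : 6 * 10 ^ 14 * ρ ^ 2 ≤ ε ^ 2) (hτ : 0 < τ)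
    (hτ1 : τ ≤ 1 / 1000000) (h0 : IsProjective h K u v₀ ψ₀) (hv₀ : lyap h K v₀ ≤ ε ^ 2) :
    ∃ ψ ψs : ℕ → ℤ → ℝ, ψ 0 = ψ₀ ∧ FullyDiscreteScheme h K τ ψ ψs := by
  let S : (ℤ → ℝ) → (ℤ → ℝ) := fun ψ => Classical.epsilon (ImplicitStep h K τ ψ)
  let F : (ℤ → ℝ) → (ℤ → ℝ) := fun ψ ℓ => S ψ ℓ / Real.sqrt (Nh h (S ψ))
  let Good : (ℤ → ℝ) → Prop := fun ψ => ∃ v, IsProjective h K u v ψ ∧ lyap h K v ≤ ε ^ 2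
  have hS : ∀ ψ, Good ψ → ImplicitStep h K τ ψ (S ψ) := fun ψ ⟨v, hp, hv⟩ =>
    Classical.epsilon_spec
      (exists_implicitStep hh hτ (by linarith) (hp.abs_le_one hu hh hε hε1 hρ hv))
  have hstep : ∀ ψ, Good ψ → 0 < Nh h (S ψ) ∧ Good (F ψ) := by
    rintro ψ hG
    have hI := hS ψ hG
    obtain ⟨v, hp, hv⟩ := hG
    obtain ⟨h1, w, h2, h3⟩ := hp.step hu hh hε hε1 hρ hτ hτ1 hv hI
    have hN := Nh_eq_ip (h := h) hI.1
    refine ⟨hN ▸ h1, w, by simpa only [F, hN] using h2, ?_⟩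
    have h4 := mul_le_mul_of_nonneg_left hρ2 hτ.le
    by_contra hc
    have h5 := mul_le_mul_of_nonneg_right (not_le.1 hc).le hτ.le
    linarith [not_le.1 hc]
  have hG : ∀ n, Good (F^[n] ψ₀) := by
    intro n
    induction n with
    | zero => exact ⟨v₀, h0, hv₀⟩
    | succ n ih => rw [Function.iterate_succ_apply']; exact (hstep _ ih).2
  exact ⟨fun n => F^[n] ψ₀, fun n => S (F^[n] ψ₀), rfl, fun n =>
    ⟨(hS _ (hG n)).1, (hS _ (hG n)).2, (hstep _ (hG n)).1,
      Function.iterate_succ_apply' F n ψ₀⟩⟩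

theorem scheme_lyap_le (hu : ApproxGround h K u ρ) (hh : 0 < h) (hε : 0 ≤ ε)
    (hε1 : ε ≤ 1 / 2000000) (hρ : ρ ≤ ε) (hρ2 : 6 * 10 ^ 14 * ρ ^ 2 ≤ ε ^ 2) (hτ : 0 < τ)
    (hτ1 : τ ≤ 1 / 1000000) {ψ ψs : ℕ → ℤ → ℝ} (h0 : IsProjective h K u v₀ (ψ 0))
    (hv₀ : lyap h K v₀ ≤ ε ^ 2) (hS : FullyDiscreteScheme h K τ ψ ψs) (n : ℕ) :
    ∃ v, IsProjective h K u v (ψ n) ∧ lyap h K v ≤ ε ^ 2 ∧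
      lyap h K v ≤ Real.exp (-(τ / 12000) * n) * ε ^ 2 + 6 * 10 ^ 14 * ρ ^ 2 := by
  induction n with
  | zero => exact ⟨v₀, h0, hv₀, by simp; nlinarith [sq_nonneg ρ]⟩
  | succ n ihn =>
    obtain ⟨v, hp, hv, hv'⟩ := ihn
    obtain ⟨hs1, hs2, -, hs4⟩ := hS n
    obtain ⟨-, w, h2, h3⟩ := hp.step hu hh hε hε1 hρ hτ hτ1 hv ⟨hs1, hs2⟩
    have hN : Nh h (ψs n) = _ := Nh_eq_ip (h := h) hs1
    refine ⟨w, by rw [hs4, hN]; exact h2, ?_, ?_⟩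
    · have h4 := mul_le_mul_of_nonneg_left hρ2 hτ.le
      by_contra hc
      have h5 := mul_le_mul_of_nonneg_right (not_le.1 hc).le hτ.le
      linarith [not_le.1 hc]
    · have h4 : 1 ≤ Real.exp (-(τ / 12000)) * (1 + τ / 6000) := by
        have := mul_le_mul_of_nonneg_right (Real.one_sub_le_exp_neg (τ / 12000))
          (by positivity : 0 ≤ 1 + τ / 6000)
        nlinarith
      have h5 : Real.exp (-(τ / 12000) * (n + 1 : ℕ))
          = Real.exp (-(τ / 12000) * n) * Real.exp (-(τ / 12000)) := by
        rw [← Real.exp_add]; push_cast; ring_nf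
      rw [h5]
      have h6 := mul_le_mul_of_nonneg_left h4
        (by positivity : 0 ≤ Real.exp (-(τ / 12000) * n) * ε ^ 2)
      refine le_of_mul_le_mul_right ?_ (by positivity : 0 < 1 + τ / 6000)
      linarith

end Scheme

theorem Real.cosh_sub_one_bounds {t : ℝ} (ht : |t| ≤ 1) :
    t ^ 2 / 2 ≤ Real.cosh t - 1 ∧ Real.cosh t - 1 ≤ t ^ 2 / 2 + t ^ 4 / 4 := by
  constructor
  · have h1 : Real.cosh t = 1 + 2 * Real.sinh (t / 2) ^ 2 := by
      have := Real.cosh_two_mul (t / 2)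
      rw [Real.cosh_sq, mul_div_cancel₀ _ two_ne_zero] at this
      linarith
    have h2 : (t / 2) ^ 2 ≤ Real.sinh (t / 2) ^ 2 := by
      rw [← sq_abs, ← sq_abs (Real.sinh _), Real.abs_sinh]
      exact pow_le_pow_left₀ (abs_nonneg _) (Real.self_le_sinh_iff.2 (abs_nonneg _)) 2
    linarith
  · have h1 := Real.cosh_le_exp_half_sq t
    have h3 : t ^ 2 ≤ 1 := (sq_le_one_iff_abs_le_one _).2 ht
    have h2 := (abs_le.1 (Real.abs_exp_sub_one_sub_id_le (x := t ^ 2 / 2)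
      (by rw [abs_of_nonneg (by positivity)]; linarith))).2
    linarith [show (t ^ 2 / 2) ^ 2 = t ^ 4 / 4 by ring]

theorem eta_second_difference (x h : ℝ) :
    eta (x + h) + eta (x - h) - 2 * eta x
      = (Real.cosh (x / 2) ^ 2 * (Real.cosh (h / 2) - 1) - Real.sinh (h / 2) ^ 2)
        / (Real.cosh (x / 2) * (Real.cosh (x / 2) ^ 2 + Real.sinh (h / 2) ^ 2)) := by
  have hc := Real.cosh_pos (x / 2)
  have h1 := Real.cosh_pos ((x + h) / 2)
  have h2 := Real.cosh_pos ((x - h) / 2)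
  have e1 : Real.cosh ((x + h) / 2) * Real.cosh ((x - h) / 2)
      = Real.cosh (x / 2) ^ 2 + Real.sinh (h / 2) ^ 2 := by
    rw [add_div, sub_div, Real.cosh_add, Real.cosh_sub]
    linear_combination (Real.cosh (x / 2) ^ 2) * Real.cosh_sq (h / 2)
      + (Real.sinh (h / 2) ^ 2) * Real.cosh_sq (x / 2)
  have e2 : Real.cosh ((x + h) / 2) + Real.cosh ((x - h) / 2)
      = 2 * Real.cosh (x / 2) * Real.cosh (h / 2) := by
    rw [add_div, sub_div, Real.cosh_add, Real.cosh_sub]; ring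
  rw [← e1]
  unfold eta
  field_simp
  linear_combination Real.cosh (x / 2) * e2 - 2 * e1

theorem abs_eta_residual_le {h : ℝ} (hh : 0 < h) (hh1 : h ≤ 1) (x : ℝ) :
    |(1 / 2) * ((eta (x + h) + eta (x - h) - 2 * eta x) / h ^ 2) + eta x ^ 3 - eta x / 8|
      ≤ h ^ 2 * eta x := by
  obtain ⟨a1, a2⟩ := Real.cosh_sub_one_bounds (t := h / 2) (by rw [abs_of_pos (by positivity)]; linarith)
  obtain ⟨b1, b2⟩ := Real.cosh_sub_one_bounds (t := h) (by rwa [abs_of_pos hh])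
  have hq : Real.sinh (h / 2) ^ 2 = (Real.cosh h - 1) / 2 := by
    have := Real.cosh_two_mul (h / 2)
    rw [Real.cosh_sq, mul_div_cancel₀ _ two_ne_zero] at this
    linarith
  rw [eta_second_difference, hq]
  obtain ⟨a, ha⟩ : ∃ a, Real.cosh (h / 2) - 1 = h ^ 2 / 8 + a * h ^ 4 :=
    ⟨(Real.cosh (h / 2) - 1 - h ^ 2 / 8) / h ^ 4, by field_simp; ring⟩
  obtain ⟨b, hb⟩ : ∃ b, (Real.cosh h - 1) / 2 = h ^ 2 / 4 + b * h ^ 4 :=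
    ⟨((Real.cosh h - 1) / 2 - h ^ 2 / 4) / h ^ 4, by field_simp; ring⟩
  have h4 : 0 < h ^ 4 := by positivity
  have ha0 : 0 ≤ a := nonneg_of_mul_nonneg_left (by linarith : 0 ≤ a * h ^ 4) h4
  have hb0 : 0 ≤ b := nonneg_of_mul_nonneg_left (by linarith : 0 ≤ b * h ^ 4) h4
  have ha1 : a ≤ 1 / 64 := le_of_mul_le_mul_right (by linarith : a * h ^ 4 ≤ 1 / 64 * h ^ 4) h4
  have hb1 : b ≤ 1 / 8 := le_of_mul_le_mul_right (by linarith : b * h ^ 4 ≤ 1 / 8 * h ^ 4) h4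
  have hc := Real.one_le_cosh (x / 2)
  rw [ha, hb]
  unfold eta
  set c := Real.cosh (x / 2)
  have hc2 : 1 ≤ c ^ 2 := one_le_pow₀ hc
  have hh2 : h ^ 2 ≤ 1 := pow_le_one₀ hh.le hh1
  have hh0 : 0 < h ^ 2 := by positivity
  have hQ : 0 < c ^ 2 + (h ^ 2 / 4 + b * h ^ 4) := by positivity
  have e : 1 / 2 * ((c ^ 2 * (h ^ 2 / 8 + a * h ^ 4) - (h ^ 2 / 4 + b * h ^ 4))
        / (c * (c ^ 2 + (h ^ 2 / 4 + b * h ^ 4))) / h ^ 2)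
        + (1 / 2 * (1 / c)) ^ 3 - 1 / 2 * (1 / c) / 8
      = h ^ 2 * (-(c ^ 2 - 2) / c ^ 2 * (1 / 4 + b * h ^ 2) / 16 + (c ^ 2 * a - b) / 2)
        / (c * (c ^ 2 + (h ^ 2 / 4 + b * h ^ 4))) := by
    field_simp
    ring
  rw [e, abs_div, abs_mul, abs_of_pos hh0, abs_of_pos (by positivity : 0 < c * _),
    div_le_iff₀ (by positivity)]
  have h5 : |-(c ^ 2 - 2) / c ^ 2| ≤ 1 := by
    rw [abs_div, abs_of_pos (by positivity : 0 < c ^ 2), div_le_one (by positivity), abs_le]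
    constructor <;> linarith
  have h6 : b * h ^ 2 ≤ 1 / 8 * 1 := mul_le_mul hb1 hh2 hh0.le (by norm_num)
  have h7 : |-(c ^ 2 - 2) / c ^ 2 * (1 / 4 + b * h ^ 2) / 16| ≤ 1 / 16 := by
    rw [abs_div, abs_mul, abs_of_nonneg (by positivity : 0 ≤ 1 / 4 + b * h ^ 2),
      abs_of_pos (by norm_num : (0 : ℝ) < 16)]
    have := mul_le_mul h5 (by linarith : 1 / 4 + b * h ^ 2 ≤ 1) (by positivity) zero_le_one
    linarith
  have h8 : |(c ^ 2 * a - b) / 2| ≤ c ^ 2 / 8 := by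
    have := mul_le_mul_of_nonneg_left ha1 (by positivity : 0 ≤ c ^ 2)
    have := mul_nonneg (by positivity : 0 ≤ c ^ 2) ha0
    rw [abs_le]; constructor <;> linarith
  calc _ ≤ h ^ 2 * (1 / 16 + c ^ 2 / 8) :=
        mul_le_mul_of_nonneg_left ((abs_add_le _ _).trans (add_le_add h7 h8)) hh0.le
    _ ≤ h ^ 2 * (1 / 2 * c ^ 2) := by gcongr; linarith
    _ = h ^ 2 * (1 / 2 * (1 / c)) * (c * (c ^ 2 + 0)) := by field_simp; ring
    _ ≤ _ := by gcongr; positivity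

/-- The ground state sampled on the grid and cut off outside `[-K, K]`. -/
noncomputable def etaCut (h : ℝ) (K : ℕ) (j : ℤ) : ℝ := if |j| ≤ (K : ℤ) then eta (j * h) else 0

section etaCut

variable {h : ℝ} {K : ℕ}

theorem etaCut_of_le {j : ℤ} (hj : |j| ≤ (K : ℤ)) : etaCut h K j = eta (j * h) := if_pos hj

theorem suppIn_etaCut : SuppIn K (etaCut h K) := fun _ hj => if_neg (not_le.2 hj)

theorem etaCut_neg (j : ℤ) : etaCut h K (-j) = etaCut h K j := by
  unfold etaCut
  rw [abs_neg, Int.cast_neg, neg_mul, eta_neg]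

theorem etaCut_nonneg (j : ℤ) : 0 ≤ etaCut h K j := by
  unfold etaCut; split_ifs; exacts [(eta_pos _).le, le_rfl]

theorem etaCut_le_half (j : ℤ) : etaCut h K j ≤ 1 / 2 := by
  unfold etaCut; split_ifs; exacts [eta_le_half _, by norm_num]

theorem eta_sub_etaCut_bounds (hh : 0 < h) (j : ℤ) :
    0 ≤ eta (j * h) - etaCut h K j ∧ eta (j * h) - etaCut h K j ≤ Real.exp (-(h * K) / 2) := by
  unfold etaCut
  split_ifs with hj
  · rw [sub_self]; exact ⟨le_rfl, (Real.exp_pos _).le⟩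
  · rw [sub_zero]
    refine ⟨(eta_pos _).le, ?_⟩
    have h1 : eta (j * h) = eta (|(j : ℝ)| * h) := by
      rcases abs_choice (j : ℝ) with h | h <;> rw [h]
      rw [neg_mul, eta_neg]
    rw [h1]
    refine (eta_le_exp _).trans (Real.exp_le_exp.2 ?_)
    have h2 : (K : ℝ) ≤ |(j : ℝ)| := by
      have := (not_le.1 hj).le
      rw [← Int.cast_abs]; exact_mod_cast this
    nlinarith

theorem abs_gsResidual_etaCut_le (hh : 0 < h) (hh1 : h ≤ 1) {j : ℤ} (hj : |j| ≤ (K : ℤ)) :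
    |gsResidual h (etaCut h K) j|
      ≤ h ^ 2 * |etaCut h K j| + (1 / h ^ 2 * Real.exp (-(h * K) / 2)) * |1| := by
  have h1 := abs_eta_residual_le hh hh1 (j * h)
  obtain ⟨a1, a2⟩ := eta_sub_etaCut_bounds (K := K) hh (j + 1)
  obtain ⟨b1, b2⟩ := eta_sub_etaCut_bounds (K := K) hh (j - 1)
  have e1 : ((j + 1 : ℤ) : ℝ) * h = j * h + h := by push_cast; ring
  have e2 : ((j - 1 : ℤ) : ℝ) * h = j * h - h := by push_cast; ring
  rw [e1] at a1 a2
  rw [e2] at b1 b2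
  rw [abs_of_nonneg (etaCut_nonneg j), abs_one, mul_one]
  unfold gsResidual dLap
  rw [etaCut_of_le hj]
  have h2 : 1 / 2 * ((etaCut h K (j + 1) + etaCut h K (j - 1) - 2 * eta (j * h)) / h ^ 2)
      + eta (j * h) ^ 3 - eta (j * h) / 8
      = ((1 / 2) * ((eta (j * h + h) + eta (j * h - h) - 2 * eta (j * h)) / h ^ 2)
        + eta (j * h) ^ 3 - eta (j * h) / 8)
        - 1 / h ^ 2 * ((1 / 2) * ((eta (j * h + h) - etaCut h K (j + 1))
          + (eta (j * h - h) - etaCut h K (j - 1)))) := by ring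
  rw [h2]
  refine (abs_sub _ _).trans (add_le_add h1 ?_)
  rw [abs_of_nonneg (by positivity)]
  gcongr
  linarith

theorem abs_ip_etaCut_sub_one_le (hh : 0 < h) :
    |ip h K (etaCut h K) (etaCut h K) - 1| ≤ 2 * h + 2 * Real.exp (-(h * K)) := by
  rw [ip_even etaCut_neg etaCut_neg]
  have e1 : ∑ j ∈ Finset.range (K + 1), etaCut h K j * etaCut h K j
      = ∑ j ∈ Finset.range (K + 1), eta (j * h) * eta (j * h) := by
    refine Finset.sum_congr rfl fun j hj => ?_
    have : |(j : ℤ)| ≤ K := by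
      have := Finset.mem_range.1 hj
      rw [abs_of_nonneg (by positivity)]; lia
    rw [etaCut_of_le this]; simp
  have h1 := (pwDeriv_eta.mul pwDeriv_eta).abs_integral_sub_sum_le hh (K + 1)
  simp only [← pow_two] at h1 e1
  have h2 := integral_eta_sq 0 ((K + 1 : ℕ) * h)
  rw [h2] at h1
  have h3 : ∫ x in 0..((K + 1 : ℕ) * h), |-(Real.tanh (x / 2) * eta x) / 2 * eta x
      + eta x * (-(Real.tanh (x / 2) * eta x) / 2)| ≤ ∫ x in 0..((K + 1 : ℕ) * h), eta x ^ 2 := by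
    refine intervalIntegral.integral_mono_on (by positivity)
      ((pwDeriv_eta.mul pwDeriv_eta).locBdd.abs.intervalIntegrable _ _)
      ((LocBdd.of_continuous continuous_eta).sq.intervalIntegrable _ _) fun x _ => ?_
    have : -(Real.tanh (x / 2) * eta x) / 2 * eta x + eta x * (-(Real.tanh (x / 2) * eta x) / 2)
        = -(Real.tanh (x / 2) * eta x ^ 2) := by ring
    rw [this, abs_neg, abs_mul, abs_of_nonneg (sq_nonneg (eta x))]
    exact mul_le_of_le_one_left (sq_nonneg _) (abs_tanh_half_le x)
  rw [h2] at h3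
  have h4 := abs_le.1 (abs_tanh_half_le ((K + 1 : ℕ) * h))
  have h5 := one_sub_tanh_half_le ((K + 1 : ℕ) * h)
  have h6 : Real.exp (-((K + 1 : ℕ) * h)) ≤ Real.exp (-(h * K)) := by
    refine Real.exp_le_exp.2 ?_
    push_cast; linarith
  have h7 : etaCut h K 0 ^ 2 ≤ 1 / 4 := sq_le_quarter (etaCut_nonneg 0) (etaCut_le_half 0)
  have h8 := sq_nonneg (etaCut h K 0)
  simp only [zero_div, Real.tanh_zero, sub_zero, ← pow_two] at h1 h3 ⊢
  rw [e1]
  have h9 := mul_le_mul_of_nonneg_left h3 hh.le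
  have h10 := mul_le_mul_of_nonneg_left h4.2 hh.le
  have h11 := mul_le_mul_of_nonneg_left h7 hh.le
  have h12 := mul_nonneg hh.le h8
  have h13 := abs_le.1 h1
  rw [abs_le]
  constructor <;> linarith

theorem sqrt_mul_exp_le (hh1 : h ≤ 1) :
    nrm h K (fun _ => 1) * Real.exp (-(h * K) / 2) ≤ 2 * Real.exp (-(h * K) / 4) := by
  have h1 : nrm h K (fun _ => 1) ≤ 2 * Real.exp (h * K / 4) := by
    refine Real.sqrt_le_iff.2 ⟨by positivity, ?_⟩
    rw [mul_pow, ← Real.exp_nat_mul]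
    have : ip h K (fun _ => 1) (fun _ => 1) = h * (2 * K + 1) := by
      have e : ((K : ℤ) + 1 + K).toNat = 2 * K + 1 := by lia
      unfold ip; simp [e]
    rw [this]
    have := Real.add_one_le_exp ((2 : ℕ) * (h * K / 4))
    push_cast at this ⊢
    linarith
  calc _ ≤ 2 * Real.exp (h * K / 4) * Real.exp (-(h * K) / 2) := by gcongr
    _ = _ := by rw [mul_assoc, ← Real.exp_add]; ring_nf

theorem approxGround_etaCut (hh : 0 < h) (hh1 : h ≤ 1 / 12000) :
    ApproxGround h K (etaCut h K) (4 * (h + 1 / h ^ 2 * Real.exp (-(h * K) / 4))) := by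
  have hle : h ≤ 1 := by linarith
  have hmass := abs_ip_etaCut_sub_one_le (K := K) hh
  have hexp : Real.exp (-(h * K)) ≤ Real.exp (-(h * K) / 4) := by
    refine Real.exp_le_exp.2 ?_
    have : 0 ≤ h * K := by positivity
    linarith
  have hexp1 : Real.exp (-(h * K)) ≤ 1 := Real.exp_le_one_iff.2 (by
    have : 0 ≤ h * K := by positivity
    linarith)
  have hinv : 1 ≤ 1 / h ^ 2 := by
    rw [le_div_iff₀ (by positivity), one_mul]; exact pow_le_one₀ hh.le hle
  have hexp2 : Real.exp (-(h * K) / 4) ≤ 1 / h ^ 2 * Real.exp (-(h * K) / 4) :=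
    le_mul_of_one_le_left (Real.exp_pos _).le hinv
  have hexp3 := Real.exp_pos (-(h * K) / 4)
  refine ⟨suppIn_etaCut, etaCut_neg, etaCut_nonneg, etaCut_le_half, ?_, by linarith, ?_⟩
  · have h1 := nrm_le_of_abs_le_five (h := h) (K := K) (f := gsResidual h (etaCut h K))
      (g₁ := etaCut h K) (g₂ := fun _ => 1) (g₃ := 0) (g₄ := 0) (g₅ := 0) hh
      (by positivity : 0 ≤ h ^ 2) (by positivity : 0 ≤ 1 / h ^ 2 * Real.exp (-(h * K) / 2))
      le_rfl le_rfl le_rfl (fun j hj => by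
        simpa using abs_gsResidual_etaCut_le hh hle hj)
    have h2 : nrm h K (etaCut h K) ≤ 2 := by
      have := (abs_le.1 hmass).2
      refine Real.sqrt_le_iff.2 ⟨by norm_num, by linarith⟩
    have h3 := mul_le_mul_of_nonneg_left (sqrt_mul_exp_le (K := K) hle)
      (by positivity : 0 ≤ 1 / h ^ 2)
    have h4 : h ^ 2 * nrm h K (etaCut h K) ≤ h * 2 := by
      refine mul_le_mul ?_ h2 (nrm_nonneg _) hh.le
      rw [pow_two]; exact mul_le_of_le_one_left hh.le hle
    have h5 : 0 < 1 / h ^ 2 * Real.exp (-(h * K) / 4) := by positivity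
    linarith
  · intro w hw hwe how
    have e1 : ip h K (fun j => eta (j * h)) w = ip h K (etaCut h K) w :=
      ip_congr fun j hj => by rw [etaCut_of_le hj]
    have e2 : ip h K (fun j => etaCut h K j ^ 2 * w j) w
        = ip h K (fun j => eta (j * h) ^ 2 * w j) w :=
      ip_congr fun j hj => by rw [etaCut_of_le hj]
    rw [e2]
    exact discrete_coercivity hh hh1 hw hwe (e1.trans how)

end etaCut

section Interpolation

variable {h : ℝ} {K : ℕ} {ψ : ℤ → ℝ}

theorem hatFn_neg (x : ℝ) : hatFn (-x) = hatFn x := by unfold hatFn; rw [abs_neg]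

theorem ih_neg (hψ : ∀ j, ψ (-j) = ψ j) (x : ℝ) : ih h ψ (-x) = ih h ψ x := by
  unfold ih
  rw [← (Equiv.neg ℤ).tsum_eq]
  refine tsum_congr fun j => ?_
  rw [Equiv.neg_apply, hψ, ← hatFn_neg]
  congr 2
  push_cast
  ring

theorem ih_eq_zero (hh : 0 < h) (hψ : SuppIn K ψ) {x : ℝ} (hx : ((K + 1 : ℕ) : ℝ) * h ≤ x) :
    ih h ψ x = 0 := by
  have h1 : ((K + 1 : ℕ) : ℤ) ≤ ⌊x / h⌋ := Int.le_floor.2 (by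
    rw [le_div_iff₀ hh]; exact_mod_cast hx)
  have h2 : ∀ j : ℤ, ((K + 1 : ℕ) : ℤ) ≤ j → ψ j = 0 := fun j hj => hψ j (by
    rw [lt_abs]; left; push_cast at hj; lia)
  rw [ih_eq, h2 _ h1, h2 _ (by lia)]
  ring

theorem deriv_even_neg {p : ℝ → ℝ} (hp : ∀ x, p (-x) = p x) (x : ℝ) :
    deriv p (-x) = -deriv p x := by
  have : (fun x => p (-x)) = p := funext hp
  have h1 := deriv_comp_neg p x
  rw [this] at h1
  linarith

theorem PWDeriv.deriv_ae {p p' : ℝ → ℝ} (hp : PWDeriv p p') : ∀ᵐ x, _root_.deriv p x = p' x := by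
  obtain ⟨s, hs, hsd⟩ := hp.deriv
  filter_upwards [hs.ae_notMem volume] with x hx
  exact (hsd x hx).deriv

theorem eta_sq_add_deriv_sq_le (x : ℝ) :
    (-eta x) ^ 2 + (-(-(Real.tanh (x / 2) * eta x) / 2)) ^ 2 ≤ 2 * Real.exp (-x) := by
  have h1 : eta x ^ 2 ≤ Real.exp (-x) := by
    have := pow_le_pow_left₀ (eta_pos x).le (eta_le_exp x) 2
    rw [← Real.exp_nat_mul] at this
    refine this.trans_eq ?_
    congr 1; push_cast; ring
  have h2 : Real.tanh (x / 2) ^ 2 ≤ 1 := (sq_le_one_iff_abs_le_one _).2 (abs_tanh_half_le x)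
  have h3 := mul_le_mul_of_nonneg_right h2 (sq_nonneg (eta x))
  have h4 := sq_nonneg (eta x)
  have : (-eta x) ^ 2 + (-(-(Real.tanh (x / 2) * eta x) / 2)) ^ 2
      = eta x ^ 2 + Real.tanh (x / 2) ^ 2 * eta x ^ 2 / 4 := by ring
  linarith

theorem pwDeriv_ih_sub_eta (hh : 0 < h) (hψ : SuppIn K ψ) :
    PWDeriv (fun x => ih h ψ x - eta x)
      (fun x => slopeFn h ψ x - -(Real.tanh (x / 2) * eta x) / 2) :=
  (pwDeriv_ih hh hψ).sub pwDeriv_eta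

theorem H1sq_ih_sub_eta (hh : 0 < h) (hψ : SuppIn K ψ) (hψe : ∀ j, ψ (-j) = ψ j) :
    ∃ T, 0 ≤ T ∧ T ≤ 4 * Real.exp (-((K + 1 : ℕ) * h)) ∧
      H1sq (fun x => ih h ψ x - eta x) = 2 * (∫ x in 0..((K + 1 : ℕ) * h),
        ((ih h ψ x - eta x) ^ 2 + (slopeFn h ψ x - -(Real.tanh (x / 2) * eta x) / 2) ^ 2)) + T := by
  set p : ℝ → ℝ := fun x => ih h ψ x - eta x with hpdef
  set p' : ℝ → ℝ := fun x => slopeFn h ψ x - -(Real.tanh (x / 2) * eta x) / 2 with hp'def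
  set R : ℝ := (K + 1 : ℕ) * h with hR
  have hR0 : 0 ≤ R := by positivity
  have hp : PWDeriv p p' := pwDeriv_ih_sub_eta hh hψ
  let g : ℝ → ℝ := fun x => p x ^ 2 + deriv p x ^ 2
  have hpe : ∀ x, p (-x) = p x := fun x => by simp only [hpdef, ih_neg hψe, eta_neg]
  have hge : ∀ x, g |x| = g x := fun x => by
    rcases abs_choice x with hx | hx <;> rw [hx]
    simp only [g, hpe, deriv_even_neg hpe, neg_sq]
  have hgae : ∀ᵐ x, g x = p x ^ 2 + p' x ^ 2 := by
    filter_upwards [hp.deriv_ae] with x hx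
    simp only [g, hx]
  have hInt : IntervalIntegrable (fun x => p x ^ 2 + p' x ^ 2) volume 0 R :=
    ((LocBdd.of_continuous hp.cont).sq.add hp.locBdd.sq).intervalIntegrable _ _
  have hInt' : IntervalIntegrable g volume 0 R :=
    hInt.congr_ae (ae_restrict_of_ae (hgae.mono fun x hx => hx.symm))
  have htail : ∀ x ∈ Set.Ioi R,
      g x = (-eta x) ^ 2 + (-(-(Real.tanh (x / 2) * eta x) / 2)) ^ 2 := fun x hx => by
    have h1 : p =ᶠ[nhds x] fun y => -eta y := by
      filter_upwards [Ioi_mem_nhds hx] with y hy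
      simp only [hpdef, ih_eq_zero hh hψ (le_of_lt hy), zero_sub]
    simp only [g]
    rw [h1.deriv_eq, h1.eq_of_nhds, (hasDerivAt_eta x).fun_neg.deriv]
  have hexp : IntegrableOn (fun x => 2 * Real.exp (-x)) (Set.Ioi R) :=
    (integrableOn_exp_neg_Ioi R).const_mul 2
  have hgt : IntegrableOn g (Set.Ioi R) := by
    refine IntegrableOn.congr_fun (f := fun x =>
      (-eta x) ^ 2 + (-(-(Real.tanh (x / 2) * eta x) / 2)) ^ 2) ?_
      (fun x hx => (htail x hx).symm) measurableSet_Ioi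
    refine Integrable.mono' hexp ?_ (Filter.Eventually.of_forall fun x => ?_)
    · have h1 := continuous_eta
      have h2 := continuous_tanh_half
      exact Continuous.aestronglyMeasurable (by fun_prop)
    · rw [Real.norm_of_nonneg (by positivity)]
      exact eta_sq_add_deriv_sq_le x
  refine ⟨2 * ∫ x in Set.Ioi R, g x, ?_, ?_, ?_⟩
  · exact mul_nonneg zero_le_two (integral_nonneg fun x => by positivity)
  · have h1 : ∫ x in Set.Ioi R, g x ≤ ∫ x in Set.Ioi R, 2 * Real.exp (-x) :=
      setIntegral_mono_on hgt hexp measurableSet_Ioi fun x hx => by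
        rw [htail x hx]; exact eta_sq_add_deriv_sq_le x
    rw [integral_const_mul, integral_exp_neg_Ioi] at h1
    linarith
  · have h1 : H1sq p = ∫ x, g |x| := integral_congr_ae (.of_forall fun x => (hge x).symm)
    have h2 : Set.Ioi (0 : ℝ) = Set.Ioc 0 R ∪ Set.Ioi R := (Set.Ioc_union_Ioi_eq_Ioi hR0).symm
    have h3 : IntegrableOn g (Set.Ioc 0 R) := (intervalIntegrable_iff_integrableOn_Ioc_of_le hR0).1 hInt'
    rw [h1, integral_comp_abs, h2, setIntegral_union Set.Ioc_disjoint_Ioi_same measurableSet_Ioi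
      h3 hgt, ← intervalIntegral.integral_of_le hR0,
      intervalIntegral.integral_congr_ae (hgae.mono fun x hx _ => hx)]
    ring

end Interpolation

section Comparison

variable {h : ℝ} {K : ℕ} {ψ : ℤ → ℝ}

theorem PWDeriv.integral_add_sq {p p' : ℝ → ℝ} (hp : PWDeriv p p') (a b : ℝ) :
    ∫ x in a..b, (p x ^ 2 + p' x ^ 2) = (∫ x in a..b, p x ^ 2) + ∫ x in a..b, p' x ^ 2 :=
  intervalIntegral.integral_add ((LocBdd.of_continuous hp.cont).sq.intervalIntegrable _ _)
    (hp.locBdd.sq.intervalIntegrable _ _)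

theorem integral_deriv_deriv_eta_sq_le {R : ℝ} (hR : 0 ≤ R) :
    ∫ x in 0..R, (eta x / 4 - 2 * eta x ^ 3) ^ 2 ≤ 1 / 2 := by
  have h1 : ∫ x in 0..R, (eta x / 4 - 2 * eta x ^ 3) ^ 2 ≤ ∫ x in 0..R, eta x ^ 2 := by
    refine intervalIntegral.integral_mono_on hR
      (pwDeriv_deriv_eta.locBdd.sq.intervalIntegrable _ _)
      ((LocBdd.of_continuous continuous_eta).sq.intervalIntegrable _ _) fun x _ => ?_
    have e : (eta x / 4 - 2 * eta x ^ 3) ^ 2 = (1 / 4 - 2 * eta x ^ 2) ^ 2 * eta x ^ 2 := by ring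
    rw [e]
    refine mul_le_of_le_one_left (sq_nonneg _) ?_
    have := eta_sq_le x
    have := sq_nonneg (eta x)
    rw [sq_le_one_iff_abs_le_one, abs_le]
    constructor <;> linarith
  rw [integral_eta_sq] at h1
  have := (abs_le.1 (abs_tanh_half_le R)).2
  simp only [zero_div, Real.tanh_zero, sub_zero] at h1
  linarith

theorem integral_slope_sub_sq_le (hh : 0 < h) (hψ : SuppIn K ψ) :
    ∫ x in 0..((K + 1 : ℕ) * h), (slopeFn h ψ x - -(Real.tanh (x / 2) * eta x) / 2) ^ 2
      ≤ 2 * (h * ∑ j ∈ Finset.range (K + 1),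
          (((ψ (j + 1) - eta ((j + 1 : ℕ) * h)) - (ψ j - eta (j * h))) / h) ^ 2) + h ^ 2 := by
  set q' : ℝ → ℝ := fun x => -(Real.tanh (x / 2) * eta x) / 2 with hq'
  have hl := (pwDeriv_ih_sub_eta hh hψ).locBdd.sq
  have hcell : ∀ j : ℕ, ∫ x in (j * h)..((j + 1 : ℕ) * h), (slopeFn h ψ x - q' x) ^ 2
      ≤ 2 * (h * (((ψ (j + 1) - eta ((j + 1 : ℕ) * h)) - (ψ j - eta (j * h))) / h) ^ 2)
        + 2 * (h ^ 2 * ∫ x in (j * h)..((j + 1 : ℕ) * h), (eta x / 4 - 2 * eta x ^ 3) ^ 2) := by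
    intro j
    have hlt : (j : ℝ) * h < (j + 1 : ℕ) * h := by push_cast; linarith
    set d := (eta ((j + 1 : ℕ) * h) - eta (j * h)) / h with hd
    set D := (((ψ (j + 1) - eta ((j + 1 : ℕ) * h)) - (ψ j - eta (j * h))) / h) with hD
    have h1 : ∫ x in (j * h)..((j + 1 : ℕ) * h), (slopeFn h ψ x - q' x) ^ 2
        = ∫ x in (j * h)..((j + 1 : ℕ) * h), ((ψ (j + 1) - ψ j) / h - q' x) ^ 2 := by
      simpa using integral_cell_comp_slopeFn hh ψ (fun x s => (s - q' x) ^ 2) j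
    have hs : LocBdd fun x => q' x - d := pwDeriv_eta.locBdd.sub (.const d)
    have h2 : ∫ x in (j * h)..((j + 1 : ℕ) * h), ((ψ (j + 1) - ψ j) / h - q' x) ^ 2
        ≤ ∫ x in (j * h)..((j + 1 : ℕ) * h), (2 * D ^ 2 + 2 * (q' x - d) ^ 2) := by
      refine intervalIntegral.integral_mono_on hlt.le
        (((LocBdd.const _).sub pwDeriv_eta.locBdd).sq.intervalIntegrable _ _)
        (((LocBdd.const _).add ((LocBdd.const _).mul hs.sq)).intervalIntegrable _ _) fun x _ => ?_
      have : (ψ (j + 1) - ψ j) / h - q' x = D - (q' x - d) := by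
        rw [hD, hd]; ring
      rw [this]
      nlinarith [sq_nonneg (D + (q' x - d))]
    have h3 := pwDeriv_eta.integral_deriv_sub_slope_sq_le pwDeriv_deriv_eta hlt
    rw [cell_length] at h3
    rw [intervalIntegral.integral_add (intervalIntegrable_const)
      (((LocBdd.const _).mul hs.sq).intervalIntegrable _ _), intervalIntegral.integral_const,
      intervalIntegral.integral_const_mul, cell_length, smul_eq_mul] at h2
    rw [h1]
    linarith
  rw [← hl.sum_cells]
  refine (Finset.sum_le_sum fun j _ => hcell j).trans ?_
  rw [Finset.sum_add_distrib, ← Finset.mul_sum, ← Finset.mul_sum, ← Finset.mul_sum,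
    ← Finset.mul_sum, pwDeriv_deriv_eta.locBdd.sq.sum_cells]
  have := mul_le_mul_of_nonneg_left
    (integral_deriv_deriv_eta_sq_le (R := (K + 1 : ℕ) * h) (by positivity)) (sq_nonneg h)
  linarith

/-- The squared discrete `H¹` norm. -/
noncomputable def dH1 (h : ℝ) (K : ℕ) (w : ℤ → ℝ) : ℝ := ip h K w w + gip h K w w

theorem eta_last_sq_le (hh : 0 < h) : eta ((K + 1 : ℕ) * h) ^ 2 ≤ Real.exp (-(h * K)) := by
  have := pow_le_pow_left₀ (eta_pos _).le (eta_le_exp ((K + 1 : ℕ) * h)) 2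
  rw [← Real.exp_nat_mul] at this
  refine this.trans (Real.exp_le_exp.2 ?_)
  push_cast
  linarith

theorem sub_etaCut_eq {j : ℕ} (hj : j < K + 1) :
    ψ j - etaCut h K j = ψ j - eta (j * h) := by
  rw [etaCut_of_le (by rw [abs_of_nonneg] <;> lia)]; simp

theorem sum_range_sub_etaCut_sq : ∑ j ∈ Finset.range (K + 1), (ψ j - etaCut h K j) ^ 2
    = ∑ j ∈ Finset.range (K + 1), (ψ j - eta (j * h)) ^ 2 :=
  Finset.sum_congr rfl fun j hj => by rw [sub_etaCut_eq (Finset.mem_range.1 hj)]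

theorem sum_range_slope_sub_etaCut (h : ℝ) (K : ℕ) (ψ : ℤ → ℝ) : ∃ a b : ℝ,
    ∑ j ∈ Finset.range (K + 1),
      (((ψ (j + 1) - eta ((j + 1 : ℕ) * h)) - (ψ j - eta (j * h))) / h) ^ 2 = a + b ^ 2 ∧
    ∑ j ∈ Finset.range (K + 1),
      (((ψ (j + 1) - etaCut h K (j + 1)) - (ψ j - etaCut h K j)) / h) ^ 2
        = a + (b + eta ((K + 1 : ℕ) * h) / h) ^ 2 ∧ 0 ≤ a := by
  refine ⟨_, ((ψ (K + 1) - eta ((K + 1 : ℕ) * h)) - (ψ K - eta (K * h))) / h,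
    Finset.sum_range_succ _ _, ?_, Finset.sum_nonneg fun _ _ => sq_nonneg _⟩
  rw [Finset.sum_range_succ]
  congr 1
  · refine Finset.sum_congr rfl fun j hj => ?_
    have hj' := Finset.mem_range.1 hj
    have := sub_etaCut_eq (h := h) (ψ := ψ) (show j + 1 < K + 1 by lia)
    push_cast at this
    rw [sub_etaCut_eq (by lia), this]
    push_cast; ring
  · have h1 : etaCut h K (K + 1) = 0 := suppIn_etaCut _ (by rw [lt_abs]; lia)
    rw [sub_etaCut_eq (by lia), h1]
    ring

theorem sub_etaCut_even (hψe : ∀ j, ψ (-j) = ψ j) (j : ℤ) :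
    (fun j => ψ j - etaCut h K j) (-j) = (fun j => ψ j - etaCut h K j) j := by
  simp only [hψe, etaCut_neg]

theorem H1sq_le_dH1 (hh : 0 < h) (hh1 : h ≤ 1 / 2) (hψ : SuppIn K ψ)
    (hψe : ∀ j, ψ (-j) = ψ j) :
    H1sq (fun x => ih h ψ x - eta x) ≤ 12 * dH1 h K (fun j => ψ j - etaCut h K j)
      + 4 * h ^ 2 + 20 * (1 / h * Real.exp (-(h * K))) := by
  obtain ⟨T, -, hT, e⟩ := H1sq_ih_sub_eta hh hψ hψe
  have hp := pwDeriv_ih_sub_eta hh hψ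
  have hsq := hp.integral_sq_le hh (K + 1)
  have hder := integral_slope_sub_sq_le hh hψ
  have hgrid : ∀ j : ℕ, ih h ψ (j * h) = ψ j := fun j => by simpa using ih_grid hh ψ j
  simp only [hgrid] at hsq
  rw [hp.integral_add_sq] at e
  set X := ∫ x in 0..((K + 1 : ℕ) * h), (ih h ψ x - eta x) ^ 2
  set P := ∫ x in 0..((K + 1 : ℕ) * h), (slopeFn h ψ x - -(Real.tanh (x / 2) * eta x) / 2) ^ 2
  have hwe := sub_etaCut_even (h := h) (K := K) hψe
  have hws : SuppIn K fun j => ψ j - etaCut h K j := fun j hj => by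
    simp only [hψ j hj, suppIn_etaCut j hj, sub_zero]
  have hI := ip_even (h := h) (K := K) (f := fun j => ψ j - etaCut h K j)
    (g := fun j => ψ j - etaCut h K j) hwe hwe
  have hG := gip_even (h := h) (K := K) (f := fun j => ψ j - etaCut h K j)
    (g := fun j => ψ j - etaCut h K j) hwe hwe
  have h0 := sq_le_ip_add_gip (w := fun j => ψ j - etaCut h K j) hh hws hwe 0
  simp only [← pow_two] at hI hG
  rw [sum_range_sub_etaCut_sq] at hI
  obtain ⟨a, b, hab, hab', ha⟩ := sum_range_slope_sub_etaCut h K ψ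
  rw [hab'] at hG
  rw [hab] at hder
  unfold dH1
  set N := ip h K (fun j => ψ j - etaCut h K j) fun j => ψ j - etaCut h K j
  set G := gip h K (fun j => ψ j - etaCut h K j) fun j => ψ j - etaCut h K j
  set t := eta ((K + 1 : ℕ) * h) / h with ht
  have hN0 : 0 ≤ N := ip_self_nonneg hh _
  have hG0 : 0 ≤ G := gip_self_nonneg hh _
  have hlast : h * t ^ 2 ≤ 1 / h * Real.exp (-(h * K)) := by
    have : h * t ^ 2 = 1 / h * eta ((K + 1 : ℕ) * h) ^ 2 := by rw [ht]; field_simp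
    rw [this]
    exact mul_le_mul_of_nonneg_left (eta_last_sq_le hh) (by positivity)
  have hb : h * (a + b ^ 2) ≤ G + 2 * (h * t ^ 2) := by
    rw [hG]
    have h1 : a + b ^ 2 ≤ 2 * (a + (b + t) ^ 2) + 2 * t ^ 2 := by
      nlinarith [sq_nonneg (b + 2 * t)]
    have := mul_le_mul_of_nonneg_left h1 hh.le
    linarith
  have hexp : Real.exp (-((K + 1 : ℕ) * h)) ≤ 1 / h * Real.exp (-(h * K)) := by
    have h1 : Real.exp (-((K + 1 : ℕ) * h)) ≤ Real.exp (-(h * K)) :=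
      Real.exp_le_exp.2 (by push_cast; linarith)
    refine h1.trans (le_mul_of_one_le_left (Real.exp_pos _).le ?_)
    rw [le_div_iff₀ hh]; linarith
  have hP0 : 0 ≤ P := intervalIntegral.integral_nonneg (by positivity) fun _ _ => sq_nonneg _
  have hhP : h ^ 2 * P ≤ 1 / 4 * P := by
    refine mul_le_mul_of_nonneg_right ?_ hP0
    nlinarith
  have hh0 : h * ((fun j => ψ j - etaCut h K j) 0) ^ 2 ≤ 1 / 2 * (N + G) :=
    mul_le_mul hh1 h0 (sq_nonneg _) (by norm_num)
  rw [e]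
  linarith

theorem dH1_le_H1sq (hh : 0 < h) (hh1 : h ≤ 1 / 2) (hψ : SuppIn K ψ)
    (hψe : ∀ j, ψ (-j) = ψ j) :
    dH1 h K (fun j => ψ j - etaCut h K j) ≤ 4 * H1sq (fun x => ih h ψ x - eta x)
      + 4 * (1 / h * Real.exp (-(h * K))) := by
  obtain ⟨T, hT, -, e⟩ := H1sq_ih_sub_eta hh hψ hψe
  have hp := pwDeriv_ih_sub_eta hh hψ
  have hsq := hp.sum_sq_le hh (K + 1)
  have hder := hp.sum_diff_sq_le hh (K + 1)
  have hgrid : ∀ j : ℕ, ih h ψ (j * h) = ψ j := fun j => by simpa using ih_grid hh ψ j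
  simp only [hgrid] at hsq hder
  simp only [Nat.cast_add_one] at hder
  rw [hp.integral_add_sq] at e hsq
  simp only [Nat.cast_add_one] at e hsq
  have hwe := sub_etaCut_even (h := h) (K := K) hψe
  have hI := ip_even (h := h) (K := K) (f := fun j => ψ j - etaCut h K j)
    (g := fun j => ψ j - etaCut h K j) hwe hwe
  have hG := gip_even (h := h) (K := K) (f := fun j => ψ j - etaCut h K j)
    (g := fun j => ψ j - etaCut h K j) hwe hwe
  simp only [← pow_two] at hI hG
  rw [sum_range_sub_etaCut_sq] at hI
  obtain ⟨a, b, hab, hab', ha⟩ := sum_range_slope_sub_etaCut h K ψ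
  rw [hab'] at hG
  simp only [Nat.cast_add_one] at hab
  rw [hab] at hder
  set X := ∫ x in 0..(((K : ℝ) + 1) * h), (ih h ψ x - eta x) ^ 2
  set P := ∫ x in 0..(((K : ℝ) + 1) * h), (slopeFn h ψ x - -(Real.tanh (x / 2) * eta x) / 2) ^ 2
  have hX0 : 0 ≤ X := intervalIntegral.integral_nonneg (by positivity) fun _ _ => sq_nonneg _
  have hP0 : 0 ≤ P := intervalIntegral.integral_nonneg (by positivity) fun _ _ => sq_nonneg _
  unfold dH1
  rw [hI, hG]
  set t := eta ((K + 1 : ℕ) * h) / h with ht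
  have hlast : h * t ^ 2 ≤ 1 / h * Real.exp (-(h * K)) := by
    have : h * t ^ 2 = 1 / h * eta ((K + 1 : ℕ) * h) ^ 2 := by rw [ht]; field_simp
    rw [this]
    exact mul_le_mul_of_nonneg_left (eta_last_sq_le hh) (by positivity)
  have h1 : a + (b + t) ^ 2 ≤ 2 * (a + b ^ 2) + 2 * t ^ 2 := by
    nlinarith [sq_nonneg (b - t)]
  have h2 := mul_le_mul_of_nonneg_left h1 hh.le
  have h3 := mul_le_mul_of_nonneg_right hh1 (add_nonneg hX0 hP0)
  have h4 := mul_nonneg hh.le (sq_nonneg (ψ 0 - etaCut h K 0))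
  linarith

end Comparison

section Assembly

variable {h ρ : ℝ} {K : ℕ} {u v ψ : ℤ → ℝ}

theorem dH1_nonneg (hh : 0 < h) (f : ℤ → ℝ) : 0 ≤ dH1 h K f :=
  add_nonneg (ip_self_nonneg hh f) (gip_self_nonneg hh f)

theorem dH1_smul (a : ℝ) (f : ℤ → ℝ) : dH1 h K (fun j => a * f j) = a ^ 2 * dH1 h K f := by
  simp only [dH1, ip, gip, mul_add, Finset.mul_sum]
  congr 1 <;> exact Finset.sum_congr rfl fun j _ => by ring

theorem dH1_comb_le (hh : 0 < h) (a b : ℝ) (f g : ℤ → ℝ) :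
    dH1 h K (fun j => a * f j + b * g j) ≤ 2 * a ^ 2 * dH1 h K f + 2 * b ^ 2 * dH1 h K g := by
  have e : dH1 h K (fun j => a * f j + b * g j) + dH1 h K (fun j => a * f j - b * g j)
      = 2 * a ^ 2 * dH1 h K f + 2 * b ^ 2 * dH1 h K g := by
    have e1 : ip h K (fun j => a * f j + b * g j) (fun j => a * f j + b * g j)
        + ip h K (fun j => a * f j - b * g j) (fun j => a * f j - b * g j)
        = 2 * a ^ 2 * ip h K f f + 2 * b ^ 2 * ip h K g g := by
      simp only [ip, Finset.mul_sum, ← Finset.sum_add_distrib]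
      exact Finset.sum_congr rfl fun j _ => by ring
    have e2 : gip h K (fun j => a * f j + b * g j) (fun j => a * f j + b * g j)
        + gip h K (fun j => a * f j - b * g j) (fun j => a * f j - b * g j)
        = 2 * a ^ 2 * gip h K f f + 2 * b ^ 2 * gip h K g g := by
      simp only [gip, Finset.mul_sum, ← Finset.sum_add_distrib]
      exact Finset.sum_congr rfl fun j _ => by ring
    unfold dH1
    linarith
  have := dH1_nonneg (K := K) hh (fun j => a * f j - b * g j)
  linarith

theorem dH1_le_lyap (hh : 0 < h) (f : ℤ → ℝ) : dH1 h K f ≤ lyap h K f := by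
  have := ip_self_nonneg (K := K) hh f
  unfold dH1 lyap
  linarith

theorem lyap_le_dH1 (hh : 0 < h) (f : ℤ → ℝ) : lyap h K f ≤ 96000 * dH1 h K f := by
  have := gip_self_nonneg (K := K) hh f
  unfold dH1 lyap
  linarith

theorem ApproxGround.dH1_le (hu : ApproxGround h K u ρ) (hh : 0 < h) (hρ : ρ ≤ 1 / 100) :
    dH1 h K u ≤ 4 := by
  have hmass := (abs_le.1 hu.mass).2
  have e : gip h K u u = 2 * ip h K (fun j => u j ^ 3) u - 1 / 4 * ip h K u u
      - 2 * ip h K (gsResidual h u) u := by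
    have h1 := ip_dLap hh u hu.supp
    have h2 : ip h K (dLap h u) u = 2 * ip h K (gsResidual h u) u
        + 1 / 4 * ip h K u u - 2 * ip h K (fun j => u j ^ 3) u := by
      simp only [ip, gsResidual, Finset.mul_sum, ← Finset.sum_add_distrib,
        ← Finset.sum_sub_distrib]
      exact Finset.sum_congr rfl fun j _ => by ring
    linarith
  have h3 : ip h K (fun j => u j ^ 3) u ≤ 1 / 4 * ip h K u u := by
    unfold ip
    have : ∑ j ∈ Finset.Icc (-(K : ℤ)) K, u j ^ 3 * u j
        ≤ 1 / 4 * ∑ j ∈ Finset.Icc (-(K : ℤ)) K, u j * u j := by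
      rw [Finset.mul_sum]
      refine Finset.sum_le_sum fun j _ => ?_
      have := mul_le_mul_of_nonneg_right (sq_le_quarter (hu.nonneg j) (hu.le_half j))
        (mul_self_nonneg (u j))
      linarith
    have := mul_le_mul_of_nonneg_left this hh.le
    linarith
  have h4 := (abs_le.1 (abs_ip_le (K := K) hh (gsResidual h u) u)).1
  have h5 : nrm h K (gsResidual h u) * nrm h K u ≤ 1 / 100 * (11 / 10) :=
    mul_le_mul (hu.residual_le.trans hρ) (hu.nrm_le hρ) (nrm_nonneg u) (by norm_num)
  unfold dH1
  linarith

theorem IsProjective.suppIn (hp : IsProjective h K u v ψ) (hu : ApproxGround h K u ρ) :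
    SuppIn K ψ := fun j hj => by
  rw [hp.eq, hu.supp j hj, hp.supp j hj, add_zero, zero_div]

theorem IsProjective.dH1_sub_le (hp : IsProjective h K u v ψ) (hu : ApproxGround h K u ρ)
    (hh : 0 < h) (hρ : ρ ≤ 1 / 2000000) (hv : lyap h K v ≤ 1 / 2000000) :
    dH1 h K (fun j => ψ j - u j) ≤ 24 * ρ ^ 2 + 27 * lyap h K v := by
  have hV0 := ip_self_nonneg (K := K) hh v
  have hVl : ip h K v v ≤ lyap h K v := by
    have := gip_self_nonneg (K := K) hh v
    unfold lyap
    linarith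
  obtain ⟨α, hα1, hα2, hα3, hα4⟩ := IsProjective.factor_bounds (v := v) hu hh hρ (by linarith)
  have hmass := abs_le.1 hu.mass
  have hdu := hu.dH1_le hh (by linarith)
  have hdv := dH1_le_lyap (K := K) hh v
  have hdv0 := dH1_nonneg (K := K) hh v
  have e : (fun j => ψ j - u j) = fun j => (α - 1) * u j + α * v j := by
    ext j
    rw [hp.eq, div_eq_mul_one_div, ← hα4]
    ring
  have h1 := dH1_comb_le (K := K) hh (α - 1) α u v
  rw [← e] at h1
  set L := lyap h K v
  set V := ip h K v v
  set s := ip h K u u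
  have hα5 : α ^ 2 ≤ 1.03 := by nlinarith
  have h2 : (α - 1) ^ 2 ≤ 3 * ρ ^ 2 + 3 * L := by
    have h3 : (1 - s - V) ^ 2 ≤ (ρ + V) ^ 2 :=
      sq_le_sq' (by linarith [hmass.1, hmass.2]) (by linarith [hmass.1, hmass.2])
    have h4 : (α - 1) ^ 2 ≤ (α ^ 2 - 1) ^ 2 := by
      have : (α ^ 2 - 1) ^ 2 = (α + 1) ^ 2 * (α - 1) ^ 2 := by ring
      rw [this]
      exact le_mul_of_one_le_left (sq_nonneg _) (by nlinarith)
    have h5 : α ^ 2 - 1 = α ^ 2 * (1 - s - V) := by linarith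
    have h6 : (α ^ 2 - 1) ^ 2 ≤ 1.1 * (ρ + V) ^ 2 := by
      rw [h5, mul_pow]
      exact mul_le_mul (by nlinarith [sq_nonneg α]) h3 (sq_nonneg _) (by norm_num)
    have h7 : (ρ + V) ^ 2 ≤ 2 * ρ ^ 2 + 2 * V ^ 2 := by nlinarith [sq_nonneg (ρ - V)]
    have h8 : V ^ 2 ≤ V := by nlinarith
    linarith [sq_nonneg ρ]
  have h9 : 2 * (α - 1) ^ 2 * dH1 h K u ≤ 2 * (α - 1) ^ 2 * 4 := by gcongr
  have h10 : 2 * α ^ 2 * dH1 h K v ≤ 2 * 1.03 * L := by gcongr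
  linarith

theorem exists_isProjective (hu : ApproxGround h K u ρ) (hh : 0 < h) (hρ : ρ ≤ 1 / 100)
    (hψ : SuppIn K ψ) (hψe : ∀ j, ψ (-j) = ψ j) (hψ1 : ip h K ψ ψ = 1)
    (hw : dH1 h K (fun j => ψ j - u j) ≤ 1 / 100) :
    ∃ v, IsProjective h K u v ψ ∧
      lyap h K v ≤ 14000000 * dH1 h K (fun j => ψ j - u j) := by
  have hmass := abs_le.1 hu.mass
  have hdu := hu.dH1_le hh hρ
  set w : ℤ → ℝ := fun j => ψ j - u j with hwd
  set s := ip h K u u with hs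
  set E := dH1 h K w with hE
  have hs0 : 0 < s := by linarith
  have hwE : ip h K w w ≤ E := by
    have := gip_self_nonneg (K := K) hh w
    rw [hE, dH1]; linarith
  have hip : ip h K u ψ = s + ip h K u w := by
    simp only [hs, hwd, ip, Finset.mul_sum, ← Finset.sum_add_distrib]
    exact Finset.sum_congr rfl fun j _ => by ring
  set α := ip h K u ψ / s with hα
  have hαs : (α - 1) * s = ip h K u w := by
    rw [hα, sub_mul, div_mul_cancel₀ _ hs0.ne']; linarith
  have hα1 : (α - 1) ^ 2 ≤ 4 * E := by
    have h1 := abs_ip_le (K := K) hh u w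
    have h2 : ip h K u w ^ 2 ≤ s * ip h K w w := by
      have := pow_le_pow_left₀ (abs_nonneg _) h1 2
      rwa [sq_abs, mul_pow, nrm_sq hh, nrm_sq hh] at this
    rw [← hαs] at h2
    have h3 : s * ((α - 1) ^ 2 * s) ≤ s * ip h K w w := by linarith
    have h4 := le_of_mul_le_mul_left h3 hs0
    have h5 : (α - 1) ^ 2 * (1 / 2) ≤ (α - 1) ^ 2 * s :=
      mul_le_mul_of_nonneg_left (by linarith) (sq_nonneg _)
    linarith [sq_nonneg (α - 1)]
  have hα2 : 1 / 2 ≤ α := by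
    have : |α - 1| ≤ 1 / 2 := abs_le_of_sq_le_sq (by linarith) (by norm_num)
    linarith [(abs_le.1 this).1]
  have hα0 : 0 < α := by linarith
  set v : ℤ → ℝ := fun j => ψ j / α - u j with hv
  have hαv : ∀ j, ψ j = α * (u j + v j) := fun j => by
    rw [hv]; field_simp; ring
  have horth : ip h K u v = 0 := by
    have : ip h K u v = ip h K u ψ / α - s := by
      simp only [hs, hv, ip, Finset.mul_sum, Finset.sum_div, ← Finset.sum_sub_distrib]
      exact Finset.sum_congr rfl fun j _ => by ring
    rw [this, show ip h K u ψ = α * s by rw [hα, div_mul_cancel₀ _ hs0.ne']]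
    field_simp; ring
  have hV0 := ip_self_nonneg (K := K) hh v
  have hαm : α ^ 2 * (s + ip h K v v) = 1 := by
    have : ip h K ψ ψ = α ^ 2 * (s + ip h K v v) + 2 * α ^ 2 * ip h K u v := by
      simp only [hs, ip, Finset.mul_sum, ← Finset.sum_add_distrib, mul_add]
      refine Finset.sum_congr rfl fun j _ => ?_
      rw [hαv]
      ring
    rw [hψ1, horth] at this
    linarith
  have hsqrt : Real.sqrt (s + ip h K v v) = 1 / α := by
    rw [Real.sqrt_eq_iff_mul_self_eq (by linarith) (by positivity)]
    field_simp
    linarith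
  refine ⟨v, ⟨fun j hj => ?_, fun j => ?_, horth, fun j => ?_⟩, ?_⟩
  · simp only [hv, hψ j hj, hu.supp j hj, zero_div, sub_zero]
  · simp only [hv, hψe, hu.even]
  · rw [hsqrt, div_div_eq_mul_div, div_one, hαv j, mul_comm]
  · have h1 := dH1_comb_le (K := K) hh 1 (-(α - 1)) w u
    have e : (fun j => 1 * w j + -(α - 1) * u j) = fun j => α * v j := by
      ext j
      rw [hwd]
      have := hαv j
      simp only
      linarith
    rw [e, dH1_smul] at h1
    have h2 : 2 * (-(α - 1)) ^ 2 * dH1 h K u ≤ 2 * (4 * E) * 4 := by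
      rw [neg_sq]
      have h2 := mul_le_mul hα1 hdu (dH1_nonneg hh u) (by linarith [dH1_nonneg (K := K) hh w])
      linarith
    have h3 : (1 / 4) * dH1 h K v ≤ α ^ 2 * dH1 h K v :=
      mul_le_mul_of_nonneg_right (by nlinarith) (dH1_nonneg hh v)
    have h4 := lyap_le_dH1 (K := K) hh v
    have h5 : 0 ≤ E := dH1_nonneg hh w
    linarith

theorem boundary_term_bounds (hh : 0 < h) (hh1 : h ≤ 1) {δ : ℝ} (hδ : 0 < δ)
    (hK : ⌈4 / (h ^ 3 * δ)⌉₊ ≤ K) :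
    1 / h ^ 2 * Real.exp (-(h * K) / 4) ≤ δ ∧
      1 / h * Real.exp (-(h * K)) ≤ (1 / h ^ 2 * Real.exp (-(h * K) / 4)) ^ 2 := by
  have hK' : 4 / (h ^ 3 * δ) ≤ K := Nat.ceil_le.1 hK
  constructor
  · have h1 : 1 / (h ^ 2 * δ) ≤ h * K / 4 := by
      have := mul_le_mul_of_nonneg_left hK' hh.le
      have e : h * (4 / (h ^ 3 * δ)) = 4 * (1 / (h ^ 2 * δ)) := by field_simp
      linarith
    have h2 : 1 / (h ^ 2 * δ) ≤ Real.exp (h * K / 4) := by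
      linarith [Real.add_one_le_exp (h * K / 4)]
    rw [neg_div, Real.exp_neg, ← one_div, div_mul_div_comm, one_mul,
      div_le_iff₀ (by positivity)]
    rw [div_le_iff₀ (by positivity)] at h2
    linarith
  · rw [mul_pow, ← Real.exp_nat_mul]
    refine mul_le_mul ?_ (Real.exp_le_exp.2 ?_) (Real.exp_pos _).le (by positivity)
    · rw [div_pow, one_pow]
      refine one_div_le_one_div_of_le (by positivity) ?_
      rw [← pow_mul]
      exact pow_le_of_le_one hh.le hh1 (by norm_num)
    · push_cast
      have : 0 ≤ h * K := by positivity
      linarith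

end Assembly

/-- fully discrete convergence theorem (Theorem 5.2): for `h, τ` small and `K`
large, starting from `ψ₀ ∈ V_{h,K}` with `N_h(ψ₀) = 1` and `‖i_h ψ₀ − η‖_{H¹} ≤ B`, the fully
discrete linearly implicit normalized scheme is well defined and satisfies
`‖i_h ψ_n − η‖_{H¹} ≤ C(e^{−cnτ} + h + h⁻² e^{−C₁ h K})`. -/
theorem fully_discrete_scheme_converges :
    ∃ B C C₁ c h₀ τ₀ : ℝ, 0 < B ∧ 0 < C ∧ 0 < C₁ ∧ 0 < c ∧ 0 < h₀ ∧ 0 < τ₀ ∧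
      ∃ K₀ : ℝ → ℕ,
        ∀ h τ : ℝ, 0 < h → h ≤ h₀ → 0 < τ → τ ≤ τ₀ → ∀ K : ℕ, K₀ h ≤ K →
          ∀ ψ₀ : ℤ → ℝ, memV K ψ₀ → Nh h ψ₀ = 1 →
            Real.sqrt (H1sq (fun x => ih h ψ₀ x - eta x)) ≤ B →
            (∃ ψ ψs : ℕ → ℤ → ℝ, ψ 0 = ψ₀ ∧ FullyDiscreteScheme h K τ ψ ψs) ∧
            (∀ ψ ψs : ℕ → ℤ → ℝ, ψ 0 = ψ₀ → FullyDiscreteScheme h K τ ψ ψs →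
              ∀ n : ℕ, Real.sqrt (H1sq (fun x => ih h (ψ n) x - eta x)) ≤
                C * (Real.exp (-c * n * τ) + h + (1 / h^2) * Real.exp (-C₁ * h * K))) := by
  refine ⟨1 / 10 ^ 11, 10 ^ 10, 1 / 4, 1 / 24000, 1 / 10 ^ 15, 1 / 1000000, by norm_num,
    by norm_num, by norm_num, by norm_num, by norm_num, by norm_num,
    fun h => ⌈4 / (h ^ 3 * (1 / 10 ^ 15))⌉₊, ?_⟩
  intro h τ hh hh0 hτ hτ1 K hK ψ₀ ⟨hψe, hψ⟩ hN hB
  have hh1 : h ≤ 1 / 12000 := hh0.trans (by norm_num)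
  have hh2 : h ≤ 1 / 2 := hh0.trans (by norm_num)
  obtain ⟨hg1, hg2⟩ := boundary_term_bounds hh (by linarith) (by norm_num) hK
  have hu := approxGround_etaCut (K := K) hh hh1
  set g := 1 / h ^ 2 * Real.exp (-(h * K) / 4) with hg
  have hg0 : 0 ≤ g := by positivity
  set ρ := 4 * (h + g) with hρd
  have hρ0 : 0 ≤ ρ := by positivity
  have hρ1 : ρ ≤ 8 / 10 ^ 15 := by linarith
  have hρ : ρ ≤ 1 / 2000000 := hρ1.trans (by norm_num)
  have hρ2 : 6 * 10 ^ 14 * ρ ^ 2 ≤ (1 / 2000000) ^ 2 := by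
    have := pow_le_pow_left₀ hρ0 hρ1 2
    norm_num at this ⊢
    linarith
  have hgg : g ^ 2 ≤ (1 / 10 ^ 15) ^ 2 := pow_le_pow_left₀ hg0 hg1 2
  have hHB : H1sq (fun x => ih h ψ₀ x - eta x) ≤ (1 / 10 ^ 11) ^ 2 :=
    (Real.sqrt_le_left (by norm_num)).1 hB
  have hE := dH1_le_H1sq hh hh2 hψ hψe
  have hE2 : dH1 h K (fun j => ψ₀ j - etaCut h K j) ≤ 10 / 10 ^ 22 := by
    norm_num at hgg hHB ⊢
    linarith
  have hψ1 : ip h K ψ₀ ψ₀ = 1 := (Nh_eq_ip hψ).symm.trans hN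
  obtain ⟨v₀, hp, hv₀⟩ := exists_isProjective hu hh (hρ.trans (by norm_num)) hψ hψe hψ1
    (hE2.trans (by norm_num))
  have hv₁ : lyap h K v₀ ≤ (1 / 2000000) ^ 2 := by
    refine hv₀.trans ((mul_le_mul_of_nonneg_left hE2 (by norm_num)).trans (by norm_num))
  refine ⟨exists_scheme hu hh (by norm_num) le_rfl hρ hρ2 hτ hτ1 hp hv₁, ?_⟩
  intro ψ ψs h0 hS n
  rw [← h0] at hp
  obtain ⟨v, hpn, hv, hv'⟩ := scheme_lyap_le hu hh (by norm_num) le_rfl hρ hρ2 hτ hτ1 hp hv₁ hS n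
  have hw := hpn.dH1_sub_le hu hh hρ (hv.trans (by norm_num))
  have hne : ∀ j, ψ n (-j) = ψ n j := fun j => by
    rw [hpn.eq, hpn.eq, hpn.even, etaCut_neg]
  have hH := H1sq_le_dH1 hh hh2 (hpn.suppIn hu) hne
  have e1 : -(1 / 4) * h * K = -(h * K) / 4 := by ring
  have e2 : Real.exp (-(τ / 12000) * n) = Real.exp (-(1 / 24000) * n * τ) ^ 2 := by
    rw [← Real.exp_nat_mul]; congr 1; push_cast; ring
  rw [e1, ← hg]
  rw [e2] at hv'
  have hE0 := Real.exp_pos (-(1 / 24000) * n * τ)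
  set E := Real.exp (-(1 / 24000) * n * τ)
  refine Real.sqrt_le_iff.2 ⟨by positivity, ?_⟩
  have h1 : ρ ^ 2 = 16 * (h ^ 2 + 2 * (h * g) + g ^ 2) := by rw [hρd]; ring
  have h2 : (10 ^ 10 * (E + h + g)) ^ 2
      = 10 ^ 20 * (E ^ 2 + h ^ 2 + g ^ 2 + 2 * (h * g) + 2 * (E * h) + 2 * (E * g)) := by ring
  rw [h2]
  rw [h1] at hv' hw
  have := mul_nonneg hh.le hg0
  have := mul_nonneg hE0.le hh.le
  have := mul_nonneg hE0.le hg0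
  have := sq_nonneg E
  have := sq_nonneg h
  have := sq_nonneg g
  norm_num at hv' ⊢
  linarith
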